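/- Let π/2 < w < π and write U°_{π−w} = conv(B₁ ∪ B₂ ∪ B₃), where B₁, B₂, B₃ are geodesic balls of radius w − π/2 whose centers x₁, x₂, x₃ form a regular triangle of side length π − w. Let m₁ be the midpoint of the circular arc of ∂U°_{π−w} contained in ∂B₁, let y be the point with d(m₁, y) = ε and m₁ ∈ [x₁, y], and set K_ε = conv(U°_{π−w} ∪ {y}). Then for all sufficiently small ε > 0: (1) w(K_ε) = w; (2) there is a constant c_w > 0 depending only on w such that δ(K_ε, U°) ≥ c_w·ε for every Reuleaux triangle U of width π − w; (3) there is a constant c_w′ > 0 depending only on w such that area(K_ε) − area(U°_{π−w}) ≤ c_w′·ε^{3/2}. -/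

import Mathlib

open scoped RealInnerProductSpace
open Real MeasureTheory

noncomputable section

namespace SphericalPal

/-- Ambient Euclidean space of the sphere `Sⁿ`. -/
abbrev E (n : ℕ) := EuclideanSpace ℝ (Fin (n + 1))

/-- The unit sphere `Sⁿ ⊂ ℝⁿ⁺¹`. -/
def unitSphere (n : ℕ) : Set (E n) := Metric.sphere 0 1

variable {n : ℕ}

/-- Geodesic (angular) distance on the unit sphere. -/
def gdist (x y : E n) : ℝ := Real.arccos ⟪x, y⟫

/-- The geodesic segment joining `x` and `y` on the sphere. -/
def seg (x y : E n) : Set (E n) :=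
  {z ∈ unitSphere n | gdist x z + gdist z y = gdist x y}

/-- A subset of the sphere is spherically convex if it lies on the sphere, is contained
in an open hemisphere and contains the geodesic segment joining any two of its points. -/
def SConvex (X : Set (E n)) : Prop :=
  X ⊆ unitSphere n ∧
  (∃ u ∈ unitSphere n, ∀ x ∈ X, 0 < ⟪u, x⟫) ∧
  ∀ x ∈ X, ∀ y ∈ X, seg x y ⊆ X

/-- Spherical convex hull. -/
def sconv (X : Set (E n)) : Set (E n) := ⋂₀ {C | SConvex C ∧ X ⊆ C}

/-- Relative (spherical) interior of a subset of the sphere. -/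
def sInterior (X : Set (E n)) : Set (E n) :=
  {x ∈ X | ∃ ε > 0, ∀ y ∈ unitSphere n, gdist x y < ε → y ∈ X}

/-- A spherical convex body: compact, spherically convex, with nonempty relative interior. -/
def IsConvexBody (K : Set (E n)) : Prop :=
  SConvex K ∧ IsCompact K ∧ (sInterior K).Nonempty

/-- The lune determined by `u` and `v` (intersection of the closed hemispheres
opposite to `u` and to `v`). -/
def lune (u v : E n) : Set (E n) := {x ∈ unitSphere n | ⟪x, u⟫ ≤ 0 ∧ ⟪x, v⟫ ≤ 0}

/-- The bounding hemisphere of `lune u v` contained in the great sphere orthogonal to `u`. -/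
def luneFace (u v : E n) : Set (E n) := {x ∈ unitSphere n | ⟪x, u⟫ = 0 ∧ ⟪x, v⟫ ≤ 0}

/-- The center (midpoint) of the bounding hemisphere `luneFace u v`. -/
def luneFaceCenter (u v : E n) : E n :=
  ‖(⟪u, v⟫ • u - v : E n)‖⁻¹ • (⟪u, v⟫ • u - v)

/-- The breadth of the lune `lune u v`: the geodesic distance of the centers of the
two bounding hemispheres. -/
def breadth (u v : E n) : ℝ := gdist (luneFaceCenter u v) (luneFaceCenter v u)

/-- `lune u v` is a supporting lune of `K`. -/
def IsSupportingLune (K : Set (E n)) (u v : E n) : Prop :=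
  u ∈ unitSphere n ∧ v ∈ unitSphere n ∧ u ≠ v ∧ u ≠ -v ∧
  K ⊆ lune u v ∧ (K ∩ luneFace u v).Nonempty ∧ (K ∩ luneFace v u).Nonempty

/-- The (minimal) width of a spherical convex body. -/
def width (K : Set (E n)) : ℝ :=
  sInf {b | ∃ u v : E n, IsSupportingLune K u v ∧ b = breadth u v}

/-- The width of `K` with respect to the supporting great hypersphere orthogonal to `u`:
the minimal breadth among supporting lunes of `K` having one bounding hemisphere
contained in that great hypersphere. -/
def widthAt (K : Set (E n)) (u : E n) : ℝ :=
  sInf {b | ∃ v : E n, IsSupportingLune K u v ∧ b = breadth u v}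

/-- The great hypersphere orthogonal to `u` supports `K`. -/
def IsSupportingSphere (K : Set (E n)) (u : E n) : Prop :=
  u ∈ unitSphere n ∧ (∀ x ∈ K, ⟪x, u⟫ ≤ 0) ∧ ∃ x ∈ K, ⟪x, u⟫ = 0

/-- `K` is of constant width `w`. -/
def HasConstantWidth (K : Set (E n)) (w : ℝ) : Prop :=
  ∀ u : E n, IsSupportingSphere K u → widthAt K u = w

/-- `K` is a reduced convex body. -/
def IsReduced (K : Set (E n)) : Prop :=
  IsConvexBody K ∧ ∀ L : Set (E n), IsConvexBody L → L ⊆ K → L ≠ K → width L < width K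

/-- The spherical polar set. -/
def polar (A : Set (E n)) : Set (E n) := {u ∈ unitSphere n | ∀ a ∈ A, ⟪a, u⟫ ≤ 0}

/-- Closed geodesic ball on the sphere. -/
def gball (p : E n) (r : ℝ) : Set (E n) := {x ∈ unitSphere n | gdist p x ≤ r}

/-- The inradius of `K`: the largest `r` such that some geodesic ball of radius `r`
is contained in `K`. -/
def inradius (K : Set (E n)) : ℝ :=
  sSup {r | 0 ≤ r ∧ ∃ p ∈ unitSphere n, gball p r ⊆ K}

/-- Geodesic distance from a point to a set. -/
def sdist (x : E n) (A : Set (E n)) : ℝ := sInf (gdist x '' A)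

/-- Hausdorff distance with respect to the geodesic metric. -/
def hausdorffG (A B : Set (E n)) : ℝ :=
  max (sSup ((fun x => sdist x B) '' A)) (sSup ((fun y => sdist y A) '' B))

/-- Two subsets of the sphere are congruent, i.e., isometric by an orthogonal
transformation of the ambient Euclidean space. -/
def Congruent (A B : Set (E n)) : Prop :=
  ∃ f : E n ≃ₗᵢ[ℝ] E n, f '' A = B

/-- Spherical surface measure on `S²` (2-dimensional Hausdorff measure). -/
def area (X : Set (E 2)) : ℝ := (μH[2] X).toReal

/-- The spherical angle `∠(x, p, y)` at `p` between the geodesic segments `[p,x]`, `[p,y]`. -/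
def sangle (x p y : E 2) : ℝ :=
  InnerProductGeometry.angle (x - ⟪p, x⟫ • p) (y - ⟪p, y⟫ • p)

/-- `T` is a regular spherical triangle: the spherical convex hull of three points
with equal pairwise geodesic distances, not lying on a common great circle. -/
def IsRegularTriangle (T : Set (E 2)) : Prop :=
  ∃ v₁ v₂ v₃ : E 2, v₁ ∈ unitSphere 2 ∧ v₂ ∈ unitSphere 2 ∧ v₃ ∈ unitSphere 2 ∧
    LinearIndependent ℝ ![v₁, v₂, v₃] ∧
    gdist v₁ v₂ = gdist v₂ v₃ ∧ gdist v₂ v₃ = gdist v₁ v₃ ∧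
    T = sconv {v₁, v₂, v₃}

/-- Three points on the sphere with equal pairwise geodesic distance `a`
(the vertices of a regular spherical triangle of side length `a`). -/
def IsRegularCenters (x₁ x₂ x₃ : E 2) (a : ℝ) : Prop :=
  x₁ ∈ unitSphere 2 ∧ x₂ ∈ unitSphere 2 ∧ x₃ ∈ unitSphere 2 ∧
  gdist x₁ x₂ = a ∧ gdist x₂ x₃ = a ∧ gdist x₁ x₃ = a

/-- `U` is a spherical Reuleaux triangle: intersection of three geodesic balls of radius `r`
whose centers have pairwise geodesic distance `r`. -/
def IsReuleaux (U : Set (E 2)) (r : ℝ) : Prop :=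
  ∃ x₁ x₂ x₃ : E 2, IsRegularCenters x₁ x₂ x₃ r ∧
    U = gball x₁ r ∩ gball x₂ r ∩ gball x₃ r

/-- The body `U°_{π-w}` for `w > π/2`: the spherical convex hull of three geodesic balls
of radius `w - π/2` (whose centers are meant to form a regular triangle of side `π - w`). -/
def polarReuleaux (x₁ x₂ x₃ : E 2) (w : ℝ) : Set (E 2) :=
  sconv (gball x₁ (w - π / 2) ∪ gball x₂ (w - π / 2) ∪ gball x₃ (w - π / 2))

end SphericalPal

namespace SphericalPal

variable {n : ℕ}

theorem us_iff (x : E n) : x ∈ unitSphere n ↔ ‖x‖ = 1 := by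
  simp [unitSphere]

theorem us_inner {x : E n} (hx : x ∈ unitSphere n) : ⟪x, x⟫ = 1 := by
  rw [real_inner_self_eq_norm_sq, (us_iff x).1 hx]; norm_num

theorem us_of_inner {x : E n} (hx : ⟪x, x⟫ = 1) : x ∈ unitSphere n := by
  rw [us_iff]
  rw [real_inner_self_eq_norm_sq] at hx
  nlinarith [norm_nonneg x]

theorem us_neg {x : E n} (hx : x ∈ unitSphere n) : -x ∈ unitSphere n :=
  us_of_inner (by rw [inner_neg_neg, us_inner hx])

theorem gdist_angle {x y : E n} (hx : x ∈ unitSphere n) (hy : y ∈ unitSphere n) :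
    gdist x y = InnerProductGeometry.angle x y := by
  unfold gdist InnerProductGeometry.angle
  rw [(us_iff x).1 hx, (us_iff y).1 hy]; simp

theorem gdist_comm (x y : E n) : gdist x y = gdist y x := by
  unfold gdist; rw [real_inner_comm]

theorem gdist_tri {x y z : E n} (hx : x ∈ unitSphere n) (hy : y ∈ unitSphere n)
    (hz : z ∈ unitSphere n) : gdist x z ≤ gdist x y + gdist y z := by
  rw [gdist_angle hx hy, gdist_angle hx hz, gdist_angle hy hz]
  exact InnerProductGeometry.angle_le_angle_add_angle x y z

theorem inner_bd {x y : E n} (hx : x ∈ unitSphere n) (hy : y ∈ unitSphere n) :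
    -1 ≤ ⟪x, y⟫ ∧ ⟪x, y⟫ ≤ 1 := by
  have := abs_real_inner_le_norm x y
  rw [(us_iff x).1 hx, (us_iff y).1 hy] at this
  exact abs_le.1 (by simpa using this)

theorem cos_gdist {x y : E n} (hx : x ∈ unitSphere n) (hy : y ∈ unitSphere n) :
    Real.cos (gdist x y) = ⟪x, y⟫ :=
  Real.cos_arccos (inner_bd hx hy).1 (inner_bd hx hy).2

theorem gdist_nonneg (x y : E n) : 0 ≤ gdist x y := Real.arccos_nonneg _
theorem gdist_le_pi (x y : E n) : gdist x y ≤ π := Real.arccos_le_pi _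

theorem gdist_le_iff {x y : E n} (hx : x ∈ unitSphere n) (hy : y ∈ unitSphere n) {r : ℝ}
    (h0 : 0 ≤ r) (h1 : r ≤ π) : gdist x y ≤ r ↔ Real.cos r ≤ ⟪x, y⟫ := by
  rw [← cos_gdist hx hy]
  exact (Real.strictAntiOn_cos.le_iff_ge ⟨h0, h1⟩ ⟨gdist_nonneg _ _, gdist_le_pi _ _⟩).symm

theorem eq_of_inner_one {x y : E n} (hx : x ∈ unitSphere n) (hy : y ∈ unitSphere n)
    (h : ⟪x, y⟫ = 1) : x = y :=
  (inner_eq_one_iff_of_norm_eq_one ((us_iff x).1 hx) ((us_iff y).1 hy)).1 h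

/-- spherical interpolation formula -/
theorem slerp {x y z : E n} (hx : x ∈ unitSphere n) (hy : y ∈ unitSphere n)
    (hz : z ∈ seg x y) :
    Real.sin (gdist x y) • z = Real.sin (gdist z y) • x + Real.sin (gdist x z) • y := by
  obtain ⟨hzs, hd⟩ := hz
  have h1 := cos_gdist hx hzs
  have h2 := cos_gdist hzs hy
  have h3 := cos_gdist hx hy
  rw [← hd] at h3 ⊢
  set p := gdist x z
  set q := gdist z y
  rw [← sub_eq_zero, ← inner_self_eq_zero (𝕜 := ℝ)]
  simp only [inner_sub_left, inner_sub_right, inner_add_left, inner_add_right,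
    real_inner_smul_left, real_inner_smul_right, us_inner hx, us_inner hy, us_inner hzs]
  rw [real_inner_comm x z, real_inner_comm z y, real_inner_comm x y, ← h1, ← h2, ← h3,
    Real.sin_add, Real.cos_add]
  have e1 := Real.sin_sq_add_cos_sq p
  have e2 := Real.sin_sq_add_cos_sq q
  have c1 : Real.cos p ^ 2 = 1 - Real.sin p ^ 2 := by linarith
  have c2 : Real.cos q ^ 2 = 1 - Real.sin q ^ 2 := by linarith
  ring_nf
  simp only [c1, c2]
  ring

theorem seg_cone {x y z : E n} (hx : x ∈ unitSphere n) (hy : y ∈ unitSphere n)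
    (hz : z ∈ seg x y) (hxy : gdist x y < π) :
    ∃ α β : ℝ, 0 ≤ α ∧ 0 ≤ β ∧ z = α • x + β • y := by
  rcases (gdist_nonneg x y).eq_or_lt with h0 | h0
  · have hd := hz.2
    have h1 : gdist x z = 0 := by linarith [gdist_nonneg x z, gdist_nonneg z y]
    have := cos_gdist hx hz.1
    rw [h1, Real.cos_zero] at this
    refine ⟨1, 0, by norm_num, le_rfl, ?_⟩
    rw [← eq_of_inner_one hx hz.1 this.symm]; simp
  · have hs := Real.sin_pos_of_pos_of_lt_pi h0 hxy
    have h := slerp hx hy hz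
    refine ⟨(Real.sin (gdist x y))⁻¹ * Real.sin (gdist z y),
      (Real.sin (gdist x y))⁻¹ * Real.sin (gdist x z), ?_, ?_, ?_⟩
    · exact mul_nonneg (inv_nonneg.2 hs.le)
        (Real.sin_nonneg_of_nonneg_of_le_pi (gdist_nonneg _ _) (gdist_le_pi _ _))
    · exact mul_nonneg (inv_nonneg.2 hs.le)
        (Real.sin_nonneg_of_nonneg_of_le_pi (gdist_nonneg _ _) (gdist_le_pi _ _))
    · rw [mul_smul, mul_smul, ← smul_add, ← h, smul_smul, inv_mul_cancel₀ hs.ne', one_smul]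

theorem gdist_lt_pi_of_hemi {e x y : E n} (hx : x ∈ unitSphere n) (hy : y ∈ unitSphere n)
    (h1 : 0 < ⟪e, x⟫) (h2 : 0 < ⟪e, y⟫) : gdist x y < π := by
  refine lt_of_le_of_ne (gdist_le_pi _ _) fun h => ?_
  have := cos_gdist hx hy
  rw [h, Real.cos_pi] at this
  have hy' : -y ∈ unitSphere n := us_neg hy
  have : x = -y := eq_of_inner_one hx hy' (by rw [inner_neg_right]; linarith)
  rw [this, inner_neg_right] at h1
  linarith

theorem cone_seg {e x y z : E n} (hx : x ∈ unitSphere n) (hy : y ∈ unitSphere n)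
    (hz : z ∈ unitSphere n) (h1 : 0 < ⟪e, x⟫) (h2 : 0 < ⟪e, y⟫)
    {α β : ℝ} (hα : 0 ≤ α) (hβ : 0 ≤ β) (h : z = α • x + β • y) : z ∈ seg x y := by
  refine ⟨hz, ?_⟩
  have hlt := gdist_lt_pi_of_hemi hx hy h1 h2
  have hD := cos_gdist hx hy
  have hs := cos_gdist hx hz
  have hzz := us_inner hz
  have hzy : ⟪z, y⟫ = α * ⟪x, y⟫ + β := by
    rw [h, inner_add_left, real_inner_smul_left, real_inner_smul_left, us_inner hy]; ring
  have hxz : ⟪x, z⟫ = α + β * ⟪x, y⟫ := by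
    rw [h, inner_add_right, real_inner_smul_right, real_inner_smul_right, us_inner hx]; ring
  have hn : α ^ 2 + 2 * α * β * ⟪x, y⟫ + β ^ 2 = 1 := by
    rw [h] at hzz
    simp only [inner_add_left, inner_add_right, real_inner_smul_left, real_inner_smul_right,
      us_inner hx, us_inner hy, real_inner_comm x y] at hzz
    linarith
  rw [hxz] at hs
  have hq : gdist z y = Real.arccos (α * ⟪x, y⟫ + β) := by unfold gdist; rw [hzy]
  rw [hq]
  rcases (gdist_nonneg x y).eq_or_lt with h0 | h0
  · rw [← h0, Real.cos_zero] at hD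
    rw [← h0]
    rw [← hD] at hs hn ⊢
    have : α + β = 1 := by nlinarith
    have h3 : gdist x z = 0 := by unfold gdist; rw [hxz, ← hD]; simp [this]
    rw [h3]; simp [this]
  set D := gdist x y
  set s := gdist x z
  have hsD := Real.sin_pos_of_pos_of_lt_pi h0 hlt
  have hsn : Real.sin s = β * Real.sin D := by
    have a1 : 0 ≤ Real.sin s :=
      Real.sin_nonneg_of_nonneg_of_le_pi (gdist_nonneg _ _) (gdist_le_pi _ _)
    have a2 : 0 ≤ β * Real.sin D := by positivity
    have a3 : Real.sin s ^ 2 = (β * Real.sin D) ^ 2 := by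
      rw [mul_pow, Real.sin_sq, Real.sin_sq, hs, hD]
      linear_combination -hn
    exact (pow_left_inj₀ a1 a2 two_ne_zero).1 a3
  have hc : Real.cos (D - s) = α * ⟪x, y⟫ + β := by
    rw [Real.cos_sub, hs, hsn, ← hD]
    have := Real.sin_sq_add_cos_sq D
    linear_combination β * this
  have hsd : Real.sin (D - s) = α * Real.sin D := by
    rw [Real.sin_sub, hs, hsn, ← hD]; ring
  have hle : s ≤ D := by
    by_contra hcon
    push Not at hcon
    have : Real.sin (D - s) < 0 :=
      Real.sin_neg_of_neg_of_neg_pi_lt (by linarith) (by linarith [gdist_le_pi x z])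
    rw [hsd] at this
    have : 0 ≤ α * Real.sin D := by positivity
    linarith
  rw [← hc, Real.arccos_cos (by linarith) (by linarith [gdist_nonneg x z])]
  ring

theorem SConvex_hemi {e : E n} (he : e ∈ unitSphere n) (T : Set (E n)) :
    SConvex {x : E n | x ∈ unitSphere n ∧ 0 < ⟪e, x⟫ ∧ ∀ u ∈ T, ⟪x, u⟫ ≤ 0} := by
  refine ⟨fun x hx => hx.1, ⟨e, he, fun x hx => hx.2.1⟩, ?_⟩
  intro x hx y hy z hz
  obtain ⟨α, β, hα, hβ, h⟩ := seg_cone hx.1 hy.1 hz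
    (gdist_lt_pi_of_hemi hx.1 hy.1 hx.2.1 hy.2.1)
  refine ⟨hz.1, ?_, ?_⟩
  · have h1 : 0 ≤ ⟪e, z⟫ := by
      rw [h, inner_add_right, real_inner_smul_right, real_inner_smul_right]
      have := mul_nonneg hα hx.2.1.le
      have := mul_nonneg hβ hy.2.1.le
      linarith
    refine lt_of_le_of_ne h1 fun h0 => ?_
    rw [h, inner_add_right, real_inner_smul_right, real_inner_smul_right] at h0
    have i1 := mul_nonneg hα hx.2.1.le
    have i2 := mul_nonneg hβ hy.2.1.le
    have j1 : α * ⟪e, x⟫ = 0 := by linarith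
    have j2 : β * ⟪e, y⟫ = 0 := by linarith
    have k1 : α = 0 := (mul_eq_zero.1 j1).resolve_right hx.2.1.ne'
    have k2 : β = 0 := (mul_eq_zero.1 j2).resolve_right hy.2.1.ne'
    have := us_inner hz.1
    rw [h, k1, k2] at this
    simp at this
  · intro u hu
    rw [h, inner_add_left, real_inner_smul_left, real_inner_smul_left]
    have := mul_nonpos_of_nonneg_of_nonpos hα (hx.2.2 u hu)
    have := mul_nonpos_of_nonneg_of_nonpos hβ (hy.2.2 u hu)
    linarith

theorem subset_sconv' (X : Set (E n)) : X ⊆ sconv X := fun _ hx _ hC => hC.2 hx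

theorem sconv_hemi {e : E n} (he : e ∈ unitSphere n) {X : Set (E n)}
    (hX : ∀ x ∈ X, x ∈ unitSphere n ∧ 0 < ⟪e, x⟫) {x : E n} (hx : x ∈ sconv X) :
    x ∈ unitSphere n ∧ 0 < ⟪e, x⟫ := by
  have := hx _ ⟨SConvex_hemi he ∅, fun y hy => ⟨(hX y hy).1, (hX y hy).2, by simp⟩⟩
  exact ⟨this.1, this.2.1⟩

theorem sconv_half {e u : E n} (he : e ∈ unitSphere n) {X : Set (E n)}
    (hX : ∀ x ∈ X, x ∈ unitSphere n ∧ 0 < ⟪e, x⟫) (hu : ∀ x ∈ X, ⟪x, u⟫ ≤ 0)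
    {x : E n} (hx : x ∈ sconv X) : ⟪x, u⟫ ≤ 0 := by
  have := hx _ ⟨SConvex_hemi he {u}, fun y hy => ⟨(hX y hy).1, (hX y hy).2, by simpa using hu y hy⟩⟩
  exact this.2.2 u rfl

theorem sconv_comb {e : E n} (he : e ∈ unitSphere n) {X : Set (E n)}
    (hX : ∀ x ∈ X, x ∈ unitSphere n ∧ 0 < ⟪e, x⟫) {x y z : E n} (hx : x ∈ sconv X)
    (hy : y ∈ sconv X) (hz : z ∈ unitSphere n) {α β : ℝ} (hα : 0 ≤ α) (hβ : 0 ≤ β)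
    (h : z = α • x + β • y) : z ∈ sconv X := by
  have h1 := sconv_hemi he hX hx
  have h2 := sconv_hemi he hX hy
  have := cone_seg h1.1 h2.1 hz h1.2 h2.2 hα hβ h
  intro C hC
  exact hC.1.2.2 x (hx C hC) y (hy C hC) this

/-- structure of the hull of a convex set and a point -/
theorem sconv_point {e : E n} (he : e ∈ unitSphere n) {X : Set (E n)} (hne : X.Nonempty)
    (hX : ∀ x ∈ X, x ∈ unitSphere n ∧ 0 < ⟪e, x⟫) {y : E n} (hy : y ∈ unitSphere n)
    (hey : 0 < ⟪e, y⟫) {p : E n} (hp : p ∈ sconv (sconv X ∪ {y})) :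
    ∃ α β : ℝ, ∃ k ∈ sconv X, 0 ≤ α ∧ 0 ≤ β ∧ p = α • k + β • y := by
  have hK : ∀ x ∈ sconv X, x ∈ unitSphere n ∧ 0 < ⟪e, x⟫ := fun x hx => sconv_hemi he hX hx
  have hXy : ∀ x ∈ sconv X ∪ {y}, x ∈ unitSphere n ∧ 0 < ⟪e, x⟫ := by
    rintro x (hx | hx)
    · exact hK x hx
    · rw [Set.mem_singleton_iff.1 hx]; exact ⟨hy, hey⟩
  set C : Set (E n) := {p | (p ∈ unitSphere n ∧ 0 < ⟪e, p⟫) ∧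
    ∃ α β : ℝ, ∃ k ∈ sconv X, 0 ≤ α ∧ 0 ≤ β ∧ p = α • k + β • y} with hCdef
  obtain ⟨k0, hk0⟩ := hne
  have hC : SConvex C := by
    refine ⟨fun x hx => hx.1.1, ⟨e, he, fun x hx => hx.1.2⟩, ?_⟩
    rintro x ⟨hx, α, β, k, hk, hα, hβ, h⟩ x' ⟨hx', α', β', k', hk', hα', hβ', h'⟩ z hz
    have hlt := gdist_lt_pi_of_hemi hx.1 hx'.1 hx.2 hx'.2
    have hzh := (SConvex_hemi he (∅ : Set (E n))).2.2 x ⟨hx.1, hx.2, by simp⟩ x'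
      ⟨hx'.1, hx'.2, by simp⟩ hz
    refine ⟨⟨hzh.1, hzh.2.1⟩, ?_⟩
    obtain ⟨γ, γ', hγ, hγ', hh⟩ := seg_cone hx.1 hx'.1 hz hlt
    set v : E n := (γ * α) • k + (γ' * α') • k' with hv
    have hzv : z = v + (γ * β + γ' * β') • y := by rw [hh, h, h', hv]; module
    by_cases hv0 : v = 0
    · refine ⟨0, γ * β + γ' * β', k, hk, le_rfl, by positivity, ?_⟩
      rw [hzv, hv0]; simp
    · have hn : 0 < ‖v‖ := norm_pos_iff.2 hv0
      refine ⟨‖v‖, γ * β + γ' * β', ‖v‖⁻¹ • v, ?_, hn.le, by positivity, ?_⟩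
      · refine sconv_comb he hX hk hk' ?_ (α := ‖v‖⁻¹ * (γ * α)) (β := ‖v‖⁻¹ * (γ' * α'))
          (by positivity) (by positivity) ?_
        · rw [us_iff, norm_smul, norm_inv, norm_norm, inv_mul_cancel₀ hn.ne']
        · rw [hv]; module
      · rw [smul_smul, mul_inv_cancel₀ hn.ne', one_smul]; exact hzv
  refine (hp C ⟨hC, ?_⟩).2
  rintro x (hx | hx)
  · exact ⟨hK x hx, 1, 0, x, hx, by norm_num, le_rfl, by simp⟩
  · rw [Set.mem_singleton_iff.1 hx]
    exact ⟨⟨hy, hey⟩, 0, 1, k0, subset_sconv' X hk0, le_rfl, by norm_num, by simp⟩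

/-- far point of a ball in a given direction -/
theorem gball_far {x u : E n} (hx : x ∈ unitSphere n) (hu : u ∈ unitSphere n) {ρ : ℝ}
    (h0 : 0 ≤ ρ) (h1 : ρ ≤ π) (hX : ⟪u, x⟫ ^ 2 < 1) :
    ∃ b ∈ gball x ρ, ⟪b, u⟫ = Real.cos ρ * ⟪u, x⟫ + Real.sin ρ * √(1 - ⟪u, x⟫ ^ 2) := by
  set X := ⟪u, x⟫ with hXd
  set q := √(1 - X ^ 2) with hq
  have hq0 : 0 < q := Real.sqrt_pos.2 (by linarith)
  have hq2 : q ^ 2 = 1 - X ^ 2 := Real.sq_sqrt (by linarith)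
  set b : E n := Real.cos ρ • x + (Real.sin ρ * q⁻¹) • (u - X • x) with hb
  have hxu : ⟪x, u⟫ = X := by rw [real_inner_comm]
  have hbb : ⟪b, b⟫ = 1 := by
    rw [hb]
    simp only [inner_sub_left, inner_sub_right, inner_add_left, inner_add_right,
      real_inner_smul_left, real_inner_smul_right, us_inner hx, us_inner hu, hxu, ← hXd]
    field_simp
    linear_combination (Real.sin ρ ^ 2) * (-hq2) + q ^ 2 * Real.sin_sq_add_cos_sq ρ
  have hbx : ⟪x, b⟫ = Real.cos ρ := by
    rw [hb]
    simp only [inner_sub_right, inner_add_right, real_inner_smul_right, us_inner hx, hxu]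
    ring
  have hbs := us_of_inner hbb
  refine ⟨b, ⟨hbs, ?_⟩, ?_⟩
  · rw [gdist_le_iff hx hbs h0 h1, hbx]
  · rw [hb]
    simp only [inner_sub_left, inner_add_left, real_inner_smul_left, us_inner hu, hxu]
    field_simp
    linear_combination (-Real.sin ρ) * hq2

theorem gball_polar {x u : E n} (hx : x ∈ unitSphere n) (hu : u ∈ unitSphere n) {ρ : ℝ}
    (h0 : 0 ≤ ρ) (h1 : ρ < π / 2) (h : ∀ b ∈ gball x ρ, ⟪b, u⟫ ≤ 0) :
    ⟪u, x⟫ ≤ - Real.sin ρ := by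
  have hbd := inner_bd hu hx
  have hc : 0 < Real.cos ρ := Real.cos_pos_of_mem_Ioo ⟨by linarith, h1⟩
  have hs : 0 ≤ Real.sin ρ := Real.sin_nonneg_of_nonneg_of_le_pi h0 (by linarith)
  have hxle : ⟪u, x⟫ ≤ 0 := by
    rw [real_inner_comm]
    refine h x ⟨hx, ?_⟩
    unfold gdist; rw [us_inner hx]; simpa using h0
  by_cases hX : ⟪u, x⟫ ^ 2 < 1
  · obtain ⟨b, hb, hbu⟩ := gball_far hx hu h0 (by linarith [Real.pi_pos]) hX
    have := h b hb
    rw [hbu] at this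
    set X := ⟪u, x⟫
    have hq2 : √(1 - X ^ 2) ^ 2 = 1 - X ^ 2 := Real.sq_sqrt (by linarith)
    have hq0 := Real.sqrt_nonneg (1 - X ^ 2)
    set q := √(1 - X ^ 2)
    have h3 : (Real.sin ρ * q) ^ 2 ≤ (Real.cos ρ * (-X)) ^ 2 := by
      apply pow_le_pow_left₀ (by positivity); linarith
    have h4 : Real.sin ρ ^ 2 ≤ (-X) ^ 2 := by
      rw [mul_pow, mul_pow, hq2, Real.cos_sq'] at h3
      nlinarith
    have := abs_le_abs_of_sq_le_sq h4
    rw [abs_of_nonneg hs, abs_of_nonneg (by linarith)] at this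
    linarith
  · have : ⟪u, x⟫ = -1 := by nlinarith
    rw [this]; linarith [Real.sin_le_one ρ]
where abs_le_abs_of_sq_le_sq {a b : ℝ} (h : a ^ 2 ≤ b ^ 2) : |a| ≤ |b| := sq_le_sq.1 h

theorem gball_half {x u b : E n} (hx : x ∈ unitSphere n) (hu : u ∈ unitSphere n) {ρ : ℝ}
    (h0 : 0 ≤ ρ) (h1 : ρ < π / 2) (h : ⟪u, x⟫ ≤ - Real.sin ρ) (hb : b ∈ gball x ρ) :
    ⟪b, u⟫ ≤ 0 := by
  have t := gdist_tri hu hb.1 hx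
  have hb2 : gdist b x ≤ ρ := by rw [gdist_comm]; exact hb.2
  have h2 : π / 2 + ρ ≤ gdist u x := by
    by_contra hcon
    push Not at hcon
    have := (gdist_le_iff hu hx (gdist_nonneg u x) (gdist_le_pi u x)).1 le_rfl
    have h3 := Real.cos_lt_cos_of_nonneg_of_le_pi (gdist_nonneg u x) (by linarith) hcon
    rw [add_comm, Real.cos_add_pi_div_two, cos_gdist hu hx] at h3
    linarith
  have h3 : π / 2 ≤ gdist u b := by linarith
  rw [real_inner_comm, ← cos_gdist hu hb.1]
  exact Real.cos_nonpos_of_pi_div_two_le_of_le h3 (by linarith [gdist_le_pi u b, Real.pi_pos])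

theorem breadth_eq {u v : E n} (hu : u ∈ unitSphere n) (hv : v ∈ unitSphere n)
    (h1 : u ≠ v) (h2 : u ≠ -v) : breadth u v = π - gdist u v := by
  unfold breadth gdist luneFaceCenter
  rw [← Real.arccos_neg]
  congr 1
  have hvu : ⟪v, u⟫ = ⟪u, v⟫ := real_inner_comm _ _
  have hbd := inner_bd hu hv
  have hne1 : ⟪u, v⟫ ≠ 1 := fun h => h1 (eq_of_inner_one hu hv h)
  have hne2 : ⟪u, v⟫ ≠ -1 := fun h => h2 (eq_of_inner_one hu
    (us_neg hv) (by rw [inner_neg_right, h]; norm_num))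
  rw [hvu]
  set c := ⟪u, v⟫ with hc
  have hpos : 0 < 1 - c ^ 2 := by
    have a1 : c < 1 := lt_of_le_of_ne hbd.2 hne1
    have a2 : -1 < c := lt_of_le_of_ne hbd.1 (Ne.symm hne2)
    nlinarith
  have n1 : ‖c • u - v‖ ^ 2 = 1 - c ^ 2 := by
    rw [← real_inner_self_eq_norm_sq]
    simp only [inner_sub_left, inner_sub_right, real_inner_smul_left, real_inner_smul_right,
      us_inner hu, us_inner hv, hvu, ← hc]; ring
  have n2 : ‖c • v - u‖ ^ 2 = 1 - c ^ 2 := by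
    rw [← real_inner_self_eq_norm_sq]
    simp only [inner_sub_left, inner_sub_right, real_inner_smul_left, real_inner_smul_right,
      us_inner hu, us_inner hv, hvu, ← hc]; ring
  have n3 : ‖c • v - u‖ = ‖c • u - v‖ :=
    (pow_left_inj₀ (norm_nonneg _) (norm_nonneg _) two_ne_zero).1 (n2.trans n1.symm)
  have n4 : ‖c • u - v‖ ≠ 0 := fun h => by rw [h] at n1; simp at n1; linarith
  rw [n3]
  simp only [inner_sub_left, inner_sub_right, real_inner_smul_left, real_inner_smul_right,
      us_inner hu, us_inner hv, hvu, ← hc]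
  field_simp
  rw [n1]; ring

set_option linter.unusedSimpArgs false
/-- an orthonormal frame -/
structure Frame (c e f : E 2) : Prop where
  cc : ⟪c, c⟫ = 1
  ee : ⟪e, e⟫ = 1
  ff : ⟪f, f⟫ = 1
  ce : ⟪c, e⟫ = 0
  cf : ⟪c, f⟫ = 0
  ef : ⟪e, f⟫ = 0

theorem Frame.ec {c e f : E 2} (F : Frame c e f) : ⟪e, c⟫ = 0 := by
  rw [real_inner_comm]; exact F.ce
theorem Frame.fc {c e f : E 2} (F : Frame c e f) : ⟪f, c⟫ = 0 := by
  rw [real_inner_comm]; exact F.cf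
theorem Frame.fe {c e f : E 2} (F : Frame c e f) : ⟪f, e⟫ = 0 := by
  rw [real_inner_comm]; exact F.ef

theorem Frame.expand {c e f : E 2} (F : Frame c e f) (v : E 2) :
    v = ⟪v, c⟫ • c + ⟪v, e⟫ • e + ⟪v, f⟫ • f := by
  have ho : Orthonormal ℝ ![c, e, f] := by
    rw [orthonormal_iff_ite]
    intro i j
    fin_cases i <;> fin_cases j <;>
      simp [F.cc, F.ee, F.ff, F.ce, F.cf, F.ef, F.ec, F.fc, F.fe, 
        -inner_self_eq_norm_sq_to_K]
  have hsp : ⊤ ≤ Submodule.span ℝ (Set.range ![c, e, f]) := by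
    have := ho.linearIndependent.span_eq_top_of_card_eq_finrank (by simp)
    rw [this]
  have := (OrthonormalBasis.mk ho hsp).sum_repr' v
  simp only [Fin.sum_univ_three, OrthonormalBasis.coe_mk, Matrix.cons_val] at this
  rw [real_inner_comm c v, real_inner_comm e v, real_inner_comm f v]
  exact this.symm

theorem Frame.inner {c e f : E 2} (F : Frame c e f) (a b d a' b' d' : ℝ) :
    ⟪a • c + b • e + d • f, a' • c + b' • e + d' • f⟫ = a * a' + b * b' + d * d' := by
  simp only [inner_add_left, inner_add_right, real_inner_smul_left, real_inner_smul_right,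
    F.cc, F.ee, F.ff, F.ce, F.cf, F.ef, F.ec, F.fc, F.fe]
  ring

theorem frame_exists {x₁ x₂ x₃ : E 2} {r : ℝ} (h0 : 0 < r) (h1 : r < π / 2)
    (hx : IsRegularCenters x₁ x₂ x₃ r) :
    ∃ c e f : E 2, ∃ R : ℝ, Frame c e f ∧ 0 < R ∧ R < r ∧
      Real.cos r = Real.cos R ^ 2 - Real.sin R ^ 2 / 2 ∧
      x₁ = Real.cos R • c + Real.sin R • e + (0 : ℝ) • f ∧
      x₂ = Real.cos R • c + (-(Real.sin R / 2)) • e + (Real.sin R * (√3 / 2)) • f ∧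
      x₃ = Real.cos R • c + (-(Real.sin R / 2)) • e + (-(Real.sin R * (√3 / 2))) • f := by
  obtain ⟨s1, s2, s3, d12, d23, d13⟩ := hx
  have i12 : ⟪x₁, x₂⟫ = Real.cos r := by rw [← cos_gdist s1 s2, d12]
  have i23 : ⟪x₂, x₃⟫ = Real.cos r := by rw [← cos_gdist s2 s3, d23]
  have i13 : ⟪x₁, x₃⟫ = Real.cos r := by rw [← cos_gdist s1 s3, d13]
  have i21 : ⟪x₂, x₁⟫ = Real.cos r := by rw [real_inner_comm, i12]
  have i32 : ⟪x₃, x₂⟫ = Real.cos r := by rw [real_inner_comm, i23]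
  have i31 : ⟪x₃, x₁⟫ = Real.cos r := by rw [real_inner_comm, i13]
  have i11 := us_inner s1
  have i22 := us_inner s2
  have i33 := us_inner s3
  have ha0 : 0 < Real.cos r := Real.cos_pos_of_mem_Ioo ⟨by linarith, h1⟩
  have ha1 : Real.cos r < 1 := by
    have := Real.cos_lt_cos_of_nonneg_of_le_pi le_rfl (by linarith [Real.pi_pos]) h0
    rwa [Real.cos_zero] at this
  set a := Real.cos r with ha
  set C := √((1 + 2 * a) / 3) with hC
  have hC2 : C ^ 2 = (1 + 2 * a) / 3 := Real.sq_sqrt (by linarith)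
  have hC0 : 0 < C := Real.sqrt_pos.2 (by linarith)
  have hC1 : C < 1 := by nlinarith
  have hcR : Real.cos (Real.arccos C) = C := Real.cos_arccos (by linarith) hC1.le
  set R := Real.arccos C with hR
  have hR0 : 0 < R := Real.arccos_pos.2 hC1
  have hRpi : R ≤ π := Real.arccos_le_pi _
  have hRpi' : R < π := by
    refine lt_of_le_of_ne hRpi fun h => ?_
    rw [h, Real.cos_pi] at hcR; linarith
  have hS0 : 0 < Real.sin R := Real.sin_pos_of_pos_of_lt_pi hR0 hRpi'
  have hS2 : Real.sin R ^ 2 = (2 - 2 * a) / 3 := by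
    rw [Real.sin_sq, hcR, hC2]; ring
  set S := Real.sin R
  have hRr : R < r := by
    by_contra hcon
    push Not at hcon
    have := Real.cos_le_cos_of_nonneg_of_le_pi h0.le hRpi hcon
    rw [hcR, ← ha] at this
    nlinarith
  have h3 : √3 ^ 2 = 3 := Real.sq_sqrt (by norm_num)
  have h30 : (0 : ℝ) < √3 := Real.sqrt_pos.2 (by norm_num)
  set c : E 2 := (3 * C)⁻¹ • (x₁ + x₂ + x₃) with hc
  set e : E 2 := (3 * S)⁻¹ • ((2 : ℝ) • x₁ - x₂ - x₃) with he
  set f : E 2 := (√3 * S)⁻¹ • (x₂ - x₃) with hf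
  refine ⟨c, e, f, R, ⟨?_, ?_, ?_, ?_, ?_, ?_⟩, hR0, hRr, ?_, ?_, ?_, ?_⟩
  · rw [hc]
    simp only [inner_add_left, inner_add_right, real_inner_smul_left, real_inner_smul_right,
      inner_sub_left, inner_sub_right, i12, i13, i23, i21, i31, i32, i11, i22, i33]
    field_simp
    rw [hC2]; ring
  · rw [he]
    simp only [inner_add_left, inner_add_right, real_inner_smul_left, real_inner_smul_right,
      inner_sub_left, inner_sub_right, i12, i13, i23, i21, i31, i32, i11, i22, i33]
    field_simp
    rw [hS2]; ring
  · rw [hf]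
    simp only [inner_add_left, inner_add_right, real_inner_smul_left, real_inner_smul_right,
      inner_sub_left, inner_sub_right, i12, i13, i23, i21, i31, i32, i11, i22, i33]
    field_simp
    rw [hS2, h3]; ring
  · rw [hc, he]
    simp only [inner_add_left, inner_add_right, real_inner_smul_left, real_inner_smul_right,
      inner_sub_left, inner_sub_right, i12, i13, i23, i21, i31, i32, i11, i22, i33]
    ring
  · rw [hc, hf]
    simp only [inner_add_left, inner_add_right, real_inner_smul_left, real_inner_smul_right,
      inner_sub_left, inner_sub_right, i12, i13, i23, i21, i31, i32, i11, i22, i33]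
    ring
  · rw [he, hf]
    simp only [inner_add_left, inner_add_right, real_inner_smul_left, real_inner_smul_right,
      inner_sub_left, inner_sub_right, i12, i13, i23, i21, i31, i32, i11, i22, i33]
    ring
  · rw [hcR, hC2, hS2]; ring
  · have u1 : C * (3 * C)⁻¹ = 1 / 3 := by field_simp
    have u2 : S * (3 * S)⁻¹ = 1 / 3 := by field_simp
    rw [hcR, hc, he, smul_smul, smul_smul, u1, u2]; module
  · have u1 : C * (3 * C)⁻¹ = 1 / 3 := by field_simp
    have u2 : -(S / 2) * (3 * S)⁻¹ = -(1 / 6) := by field_simp; norm_num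
    have u3 : S * (√3 / 2) * (√3 * S)⁻¹ = 1 / 2 := by field_simp
    rw [hcR, hc, he, hf, smul_smul, smul_smul, smul_smul, u1, u2, u3]; module
  · have u1 : C * (3 * C)⁻¹ = 1 / 3 := by field_simp
    have u2 : -(S / 2) * (3 * S)⁻¹ = -(1 / 6) := by field_simp; norm_num
    have u3 : -(S * (√3 / 2)) * (√3 * S)⁻¹ = -(1 / 2) := by field_simp
    rw [hcR, hc, he, hf, smul_smul, smul_smul, smul_smul, u1, u2, u3]; module

theorem reuleaux_num {a α β γ p q t : ℝ} (ha0 : 0 < a) (ha1 : a < 1)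
    (u1 : a ≤ α * 1 + β * a + γ * a) (u2 : a ≤ α * a + β * 1 + γ * a)
    (u3 : a ≤ α * a + β * a + γ * 1)
    (huu : α * (α * 1) + α * (β * a) + α * (γ * a) + (β * (α * a) + β * (β * 1) + β * (γ * a)) +
      (γ * (α * a) + γ * (β * a) + γ * (γ * 1)) = 1)
    (v1 : a ≤ p) (v2 : a ≤ q) (v3 : a ≤ t) (b1 : p ≤ 1) (b2 : q ≤ 1) (b3 : t ≤ 1) :
    a ≤ α * p + β * q + γ * t := by
  have key : ∀ α β γ p q t : ℝ, a ≤ p → a ≤ q → a ≤ t → p ≤ 1 → α ≤ 0 → 0 ≤ β → 0 ≤ γ →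
      a ≤ α * 1 + β * a + γ * a → a ≤ α * p + β * q + γ * t := by
    intro α β γ p q t hp hq ht hp1 hα hβ hγ h
    have := mul_le_mul_of_nonpos_left hp1 hα
    have := mul_le_mul_of_nonneg_left hq hβ
    have := mul_le_mul_of_nonneg_left ht hγ
    linarith
  have imp : ∀ α β γ : ℝ, α < 0 → β < 0 → a ≤ α * 1 + β * a + γ * a →
      α * α + β * β + γ * γ + 2 * a * (α * β + β * γ + α * γ) = 1 → False := by
    intro α β γ hα hβ h hn
    have hS1 : 1 < α + β + γ := by
      have : a * (α + β + γ) > a * 1 := by nlinarith only [h, hα, ha1, mul_pos_of_neg_of_neg hα (sub_neg.2 ha1)]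
      exact lt_of_mul_lt_mul_left this ha0.le
    have hγ : 1 < γ := by linarith
    have g1 : 0 < (1 - a) * (α * α + β * β + γ * γ - 1) := by
      refine mul_pos (by linarith) ?_
      nlinarith only [mul_self_nonneg α, mul_self_nonneg β, hγ]
    have g2 : 0 < a * ((α + β + γ) ^ 2 - 1) := mul_pos ha0 (by nlinarith only [hS1])
    nlinarith only [g1, g2, hn]
  rcases lt_or_ge α 0 with ha | ha <;> rcases lt_or_ge β 0 with hb | hb <;>
    rcases lt_or_ge γ 0 with hg | hg
  · exact (imp α β γ ha hb (by linarith) (by linarith)).elim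
  · exact (imp α β γ ha hb (by linarith) (by linarith)).elim
  · exact (imp α γ β ha hg (by linarith) (by linarith)).elim
  · exact key α β γ p q t v1 v2 v3 b1 ha.le hb hg (by linarith)
  · exact (imp β γ α hb hg (by linarith) (by linarith)).elim
  · have := key β α γ q p t v2 v1 v3 b2 hb.le ha hg (by linarith)
    linarith
  · have := key γ α β t p q v3 v1 v2 b3 hg.le ha hb (by linarith)
    linarith
  · have hS1 : 1 ≤ α + β + γ := by
      have h5 : 0 ≤ (α * β + β * γ + α * γ) := by positivity
      have h6 : 0 ≤ (1 - a) * (α * β + β * γ + α * γ) := mul_nonneg (by linarith) h5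
      have h7 : 1 ≤ (α + β + γ) ^ 2 := by nlinarith only [huu, h6]
      by_contra hcon
      push Not at hcon
      have h8 : 0 ≤ α + β + γ := by positivity
      nlinarith only [h7, h8, hcon]
    have m1 := mul_le_mul_of_nonneg_left v1 ha
    have m2 := mul_le_mul_of_nonneg_left v2 hb
    have m3 := mul_le_mul_of_nonneg_left v3 hg
    have m4 := mul_le_mul_of_nonneg_left hS1 ha0.le
    linarith only [m1, m2, m3, m4]

/-- Reuleaux triangles of width `r` have diameter at most `r`. -/
theorem reuleaux_diam {x₁ x₂ x₃ : E 2} {r : ℝ} (h0 : 0 < r) (h1 : r < π / 2)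
    (hx : IsRegularCenters x₁ x₂ x₃ r) {u v : E 2} (hu : u ∈ unitSphere 2)
    (hv : v ∈ unitSphere 2)
    (u1 : Real.cos r ≤ ⟪u, x₁⟫) (u2 : Real.cos r ≤ ⟪u, x₂⟫) (u3 : Real.cos r ≤ ⟪u, x₃⟫)
    (v1 : Real.cos r ≤ ⟪v, x₁⟫) (v2 : Real.cos r ≤ ⟪v, x₂⟫) (v3 : Real.cos r ≤ ⟪v, x₃⟫) :
    Real.cos r ≤ ⟪u, v⟫ := by
  obtain ⟨c, e, f, R, F, hR0, hRr, hcos, e1, e2, e3⟩ := frame_exists h0 h1 hx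
  obtain ⟨s1, s2, s3, d12, d23, d13⟩ := hx
  have i12 : ⟪x₁, x₂⟫ = Real.cos r := by rw [← cos_gdist s1 s2, d12]
  have i23 : ⟪x₂, x₃⟫ = Real.cos r := by rw [← cos_gdist s2 s3, d23]
  have i13 : ⟪x₁, x₃⟫ = Real.cos r := by rw [← cos_gdist s1 s3, d13]
  have i21 : ⟪x₂, x₁⟫ = Real.cos r := by rw [real_inner_comm, i12]
  have i32 : ⟪x₃, x₂⟫ = Real.cos r := by rw [real_inner_comm, i23]
  have i31 : ⟪x₃, x₁⟫ = Real.cos r := by rw [real_inner_comm, i13]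
  have i11 := us_inner s1
  have i22 := us_inner s2
  have i33 := us_inner s3
  have ha0 : 0 < Real.cos r := Real.cos_pos_of_mem_Ioo ⟨by linarith, h1⟩
  have ha1 : Real.cos r < 1 := by
    have := Real.cos_lt_cos_of_nonneg_of_le_pi le_rfl (by linarith [Real.pi_pos]) h0
    rwa [Real.cos_zero] at this
  have hC : 0 < Real.cos R := Real.cos_pos_of_mem_Ioo ⟨by linarith, by linarith⟩
  have hS : 0 < Real.sin R := Real.sin_pos_of_pos_of_lt_pi hR0 (by linarith [Real.pi_pos])
  have h30 : (0 : ℝ) < √3 := Real.sqrt_pos.2 (by norm_num)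
  obtain ⟨α, β, γ, hα⟩ : ∃ α β γ : ℝ, u = α • x₁ + β • x₂ + γ • x₃ := by
    set C := Real.cos R
    set S := Real.sin R
    have hc : c = (3 * C)⁻¹ • (x₁ + x₂ + x₃) := by
      rw [e1, e2, e3]
      rw [show C • c + S • e + (0 : ℝ) • f + (C • c + -(S / 2) • e + (S * (√3 / 2)) • f) +
        (C • c + -(S / 2) • e + -(S * (√3 / 2)) • f) = (3 * C) • c by module, smul_smul,
        inv_mul_cancel₀ (by positivity), one_smul]
    have hf : f = (√3 * S)⁻¹ • (x₂ - x₃) := by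
      rw [e2, e3]
      rw [show (C • c + -(S / 2) • e + (S * (√3 / 2)) • f) -
        (C • c + -(S / 2) • e + -(S * (√3 / 2)) • f) = (√3 * S) • f by module, smul_smul,
        inv_mul_cancel₀ (by positivity), one_smul]
    have he : e = (3 * S)⁻¹ • ((2 : ℝ) • x₁ - x₂ - x₃) := by
      rw [e1, e2, e3]
      rw [show (2 : ℝ) • (C • c + S • e + (0 : ℝ) • f) -
          (C • c + -(S / 2) • e + (S * (√3 / 2)) • f) -
        (C • c + -(S / 2) • e + -(S * (√3 / 2)) • f) = (3 * S) • e by module, smul_smul,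
        inv_mul_cancel₀ (by positivity), one_smul]
    have hexp := F.expand u
    generalize ⟪u, c⟫ = p at hexp
    generalize ⟪u, e⟫ = q at hexp
    generalize ⟪u, f⟫ = t at hexp
    refine ⟨p * (3 * C)⁻¹ + 2 * q * (3 * S)⁻¹, p * (3 * C)⁻¹ - q * (3 * S)⁻¹ + t * (√3 * S)⁻¹,
      p * (3 * C)⁻¹ - q * (3 * S)⁻¹ - t * (√3 * S)⁻¹, ?_⟩
    rw [hexp, hc, he, hf]
    generalize (3 * C)⁻¹ = k1
    generalize (3 * S)⁻¹ = k2
    generalize (√3 * S)⁻¹ = k3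
    module
  have huu := us_inner hu
  have huv : ⟪u, v⟫ = α * ⟪v, x₁⟫ + β * ⟪v, x₂⟫ + γ * ⟪v, x₃⟫ := by
    rw [hα]
    simp only [inner_add_left, real_inner_smul_left]
    rw [real_inner_comm v x₁, real_inner_comm v x₂, real_inner_comm v x₃]
  have b1 := (inner_bd hv s1).2
  have b2 := (inner_bd hv s2).2
  have b3 := (inner_bd hv s3).2
  rw [hα] at u1 u2 u3 huu
  simp only [inner_add_left, inner_add_right, real_inner_smul_left, real_inner_smul_right,
      i12, i13, i23, i21, i31, i32, i11, i22, i33] at u1 u2 u3 huu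
  rw [huv]
  exact reuleaux_num ha0 ha1 u1 u2 u3 huu v1 v2 v3 b1 b2 b3

/-- the configuration: a regular triangle of side `r` in an orthonormal frame centred at `c` -/
structure Cfg (r R : ℝ) (c e f x₁ x₂ x₃ : E 2) : Prop where
  F : Frame c e f
  hr0 : 0 < r
  hr1 : r < π / 2
  hR0 : 0 < R
  hRr : R < r
  hcos : Real.cos r = Real.cos R ^ 2 - Real.sin R ^ 2 / 2
  hx : IsRegularCenters x₁ x₂ x₃ r
  e1 : x₁ = Real.cos R • c + Real.sin R • e + (0 : ℝ) • f
  e2 : x₂ = Real.cos R • c + (-(Real.sin R / 2)) • e + (Real.sin R * (√3 / 2)) • f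
  e3 : x₃ = Real.cos R • c + (-(Real.sin R / 2)) • e + (-(Real.sin R * (√3 / 2))) • f

theorem cfg_exists {x₁ x₂ x₃ : E 2} {r : ℝ} (h0 : 0 < r) (h1 : r < π / 2)
    (hx : IsRegularCenters x₁ x₂ x₃ r) : ∃ R c e f, Cfg r R c e f x₁ x₂ x₃ := by
  obtain ⟨c, e, f, R, F, hR0, hRr, hcos, e1, e2, e3⟩ := frame_exists h0 h1 hx
  exact ⟨R, c, e, f, F, h0, h1, hR0, hRr, hcos, hx, e1, e2, e3⟩

variable {r R : ℝ} {c e f x₁ x₂ x₃ : E 2}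

theorem Cfg.sinR (G : Cfg r R c e f x₁ x₂ x₃) : 0 < Real.sin R :=
  Real.sin_pos_of_pos_of_lt_pi G.hR0 (by linarith [G.hRr, G.hr1, Real.pi_pos])
theorem Cfg.cosR (G : Cfg r R c e f x₁ x₂ x₃) : 0 < Real.cos R :=
  Real.cos_pos_of_mem_Ioo ⟨by linarith [G.hR0, Real.pi_pos], by linarith [G.hRr, G.hr1]⟩
theorem Cfg.cosr (G : Cfg r R c e f x₁ x₂ x₃) : 0 < Real.cos r :=
  Real.cos_pos_of_mem_Ioo ⟨by linarith [G.hr0, Real.pi_pos], G.hr1⟩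
theorem Cfg.sinr (G : Cfg r R c e f x₁ x₂ x₃) : 0 < Real.sin r :=
  Real.sin_pos_of_pos_of_lt_pi G.hr0 (by linarith [G.hr1, Real.pi_pos])

theorem Cfg.cs (G : Cfg r R c e f x₁ x₂ x₃) : c ∈ unitSphere 2 := us_of_inner G.F.cc

theorem Cfg.c1 (G : Cfg r R c e f x₁ x₂ x₃) : ⟪c, x₁⟫ = Real.cos R := by
  rw [G.e1]
  have := G.F.inner 1 0 0 (Real.cos R) (Real.sin R) 0
  simpa using this
theorem Cfg.c2 (G : Cfg r R c e f x₁ x₂ x₃) : ⟪c, x₂⟫ = Real.cos R := by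
  rw [G.e2]
  have := G.F.inner 1 0 0 (Real.cos R) (-(Real.sin R / 2)) (Real.sin R * (√3 / 2))
  simpa using this
theorem Cfg.c3 (G : Cfg r R c e f x₁ x₂ x₃) : ⟪c, x₃⟫ = Real.cos R := by
  rw [G.e3]
  have := G.F.inner 1 0 0 (Real.cos R) (-(Real.sin R / 2)) (-(Real.sin R * (√3 / 2)))
  simpa using this

theorem gdist_of_cos {x y : E n} {t : ℝ} (h0 : 0 ≤ t) (h1 : t ≤ π) (h : ⟪x, y⟫ = Real.cos t) :
    gdist x y = t := by
  unfold gdist; rw [h, Real.arccos_cos h0 h1]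

theorem Cfg.Rpi (G : Cfg r R c e f x₁ x₂ x₃) : R ≤ π := by
  linarith [G.hRr, G.hr1, Real.pi_pos]

/-- union of the three balls -/
def balls (r : ℝ) (x₁ x₂ x₃ : E 2) : Set (E 2) :=
  gball x₁ (π / 2 - r) ∪ gball x₂ (π / 2 - r) ∪ gball x₃ (π / 2 - r)

theorem Cfg.ball_c (G : Cfg r R c e f x₁ x₂ x₃) {b : E 2} (hb : b ∈ balls r x₁ x₂ x₃) :
    b ∈ unitSphere 2 ∧ 0 < ⟪c, b⟫ := by
  have key : ∀ x, x ∈ unitSphere 2 → ⟪c, x⟫ = Real.cos R → b ∈ gball x (π / 2 - r) →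
      b ∈ unitSphere 2 ∧ 0 < ⟪c, b⟫ := by
    intro x hx hcx hb
    refine ⟨hb.1, ?_⟩
    have h1 := gdist_of_cos G.hR0.le G.Rpi hcx
    have h2 := gdist_tri G.cs hx hb.1
    have h3 := hb.2
    rw [← cos_gdist G.cs hb.1]
    exact Real.cos_pos_of_mem_Ioo ⟨by linarith [gdist_nonneg c b, Real.pi_pos],
      by linarith [G.hRr]⟩
  obtain ⟨s1, s2, s3, -⟩ := G.hx
  rcases hb with (hb | hb) | hb
  · exact key _ s1 G.c1 hb
  · exact key _ s2 G.c2 hb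
  · exact key _ s3 G.c3 hb

theorem Cfg.polar_balls (G : Cfg r R c e f x₁ x₂ x₃) {u : E 2} (hu : u ∈ unitSphere 2)
    (h1 : ⟪u, x₁⟫ ≤ -Real.cos r) (h2 : ⟪u, x₂⟫ ≤ -Real.cos r) (h3 : ⟪u, x₃⟫ ≤ -Real.cos r)
    {b : E 2} (hb : b ∈ balls r x₁ x₂ x₃) : ⟪b, u⟫ ≤ 0 := by
  rw [← Real.sin_pi_div_two_sub] at h1 h2 h3
  obtain ⟨s1, s2, s3, -⟩ := G.hx
  have := G.hr0
  have := G.hr1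
  rcases hb with (hb | hb) | hb
  · exact gball_half s1 hu (by linarith) (by linarith) h1 hb
  · exact gball_half s2 hu (by linarith) (by linarith) h2 hb
  · exact gball_half s3 hu (by linarith) (by linarith) h3 hb

theorem Cfg.inners (G : Cfg r R c e f x₁ x₂ x₃) :
    ⟪x₁, x₂⟫ = Real.cos r ∧ ⟪x₂, x₃⟫ = Real.cos r ∧ ⟪x₁, x₃⟫ = Real.cos r := by
  obtain ⟨s1, s2, s3, d12, d23, d13⟩ := G.hx
  exact ⟨by rw [← cos_gdist s1 s2, d12], by rw [← cos_gdist s2 s3, d23],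
    by rw [← cos_gdist s1 s3, d13]⟩

theorem Cfg.hull_c (G : Cfg r R c e f x₁ x₂ x₃) {y : E 2} (hy : y ∈ unitSphere 2)
    (hcy : 0 < ⟪c, y⟫) :
    ∀ x ∈ sconv (balls r x₁ x₂ x₃) ∪ {y}, x ∈ unitSphere 2 ∧ 0 < ⟪c, x⟫ := by
  rintro x (hx | hx)
  · exact sconv_hemi G.cs (fun b hb => G.ball_c hb) hx
  · rw [Set.mem_singleton_iff.1 hx]; exact ⟨hy, hcy⟩

theorem Cfg.width_part (G : Cfg r R c e f x₁ x₂ x₃) {y : E 2} (hy : y ∈ unitSphere 2)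
    (hcy : 0 < ⟪c, y⟫) (hy2 : 0 ≤ ⟪y, x₂⟫) (hy3 : 0 ≤ ⟪y, x₃⟫) :
    width (sconv (sconv (balls r x₁ x₂ x₃) ∪ {y})) = π - r := by
  obtain ⟨i12, i23, i13⟩ := G.inners
  obtain ⟨s1, s2, s3, d12, d23, d13⟩ := G.hx
  have hr0 := G.hr0
  have hr1 := G.hr1
  have ha0 := G.cosr
  have hsr := G.sinr
  have ha1 : Real.cos r < 1 := by nlinarith [Real.sin_sq_add_cos_sq r]
  set K := sconv (sconv (balls r x₁ x₂ x₃) ∪ {y}) with hK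
  have hBK : balls r x₁ x₂ x₃ ⊆ K := fun b hb => subset_sconv' _ (Or.inl (subset_sconv' _ hb))
  have hKs : ∀ x ∈ K, x ∈ unitSphere 2 := fun x hx => (sconv_hemi G.cs (G.hull_c hy hcy) hx).1
  apply IsLeast.csInf_eq
  constructor
  · have hn2 : -x₂ ∈ unitSphere 2 := us_neg s2
    have hn3 : -x₃ ∈ unitSphere 2 := us_neg s3
    have hne1 : -x₂ ≠ -x₃ := by
      intro h
      have : x₂ = x₃ := neg_injective h
      rw [this, us_inner s3] at i23; linarith
    have hne2 : -x₂ ≠ - -x₃ := by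
      intro h
      have : x₂ = -x₃ := by rw [← neg_neg x₂, h]; simp
      rw [this, inner_neg_left, us_inner s3] at i23; linarith
    have hK2 : ∀ x ∈ K, ⟪x, -x₂⟫ ≤ 0 := by
      intro x hx
      refine sconv_half G.cs (G.hull_c hy hcy) ?_ hx
      rintro b (hb | hb)
      · refine sconv_half G.cs (fun b hb => G.ball_c hb) (fun b hb => ?_) hb
        refine G.polar_balls hn2 ?_ ?_ ?_ hb
        · rw [inner_neg_left, real_inner_comm, i12]
        · rw [inner_neg_left, us_inner s2]; linarith
        · rw [inner_neg_left, i23]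
      · rw [Set.mem_singleton_iff.1 hb, inner_neg_right]; linarith
    have hK3 : ∀ x ∈ K, ⟪x, -x₃⟫ ≤ 0 := by
      intro x hx
      refine sconv_half G.cs (G.hull_c hy hcy) ?_ hx
      rintro b (hb | hb)
      · refine sconv_half G.cs (fun b hb => G.ball_c hb) (fun b hb => ?_) hb
        refine G.polar_balls hn3 ?_ ?_ ?_ hb
        · rw [inner_neg_left, real_inner_comm, i13]
        · rw [inner_neg_left, real_inner_comm, i23]
        · rw [inner_neg_left, us_inner s3]; linarith
      · rw [Set.mem_singleton_iff.1 hb, inner_neg_right]; linarith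
    have touch : ∀ x x' : E 2, x ∈ unitSphere 2 → x' ∈ unitSphere 2 → ⟪x', x⟫ = Real.cos r →
        ∃ b ∈ gball x (π / 2 - r), ⟪b, -x'⟫ = 0 := by
      intro x x' hx hx' h
      have h' : ⟪-x', x⟫ = -Real.cos r := by rw [inner_neg_left, h]
      obtain ⟨b, hb, hbu⟩ := gball_far hx (us_neg hx') (ρ := π / 2 - r) (by linarith)
        (by linarith) (by rw [h']; nlinarith)
      refine ⟨b, hb, ?_⟩
      rw [hbu, h', Real.cos_pi_div_two_sub, Real.sin_pi_div_two_sub,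
        show 1 - (-Real.cos r) ^ 2 = Real.sin r ^ 2 by rw [Real.sin_sq]; ring,
        Real.sqrt_sq hsr.le]
      ring
    refine ⟨-x₂, -x₃, ⟨hn2, hn3, hne1, hne2, fun x hx => ⟨hKs x hx, hK2 x hx, hK3 x hx⟩,
      ?_, ?_⟩, ?_⟩
    · obtain ⟨b, hb, h⟩ := touch x₃ x₂ s3 s2 i23
      have hbK : b ∈ K := hBK (Or.inr hb)
      exact ⟨b, hbK, hKs b hbK, h, hK3 b hbK⟩
    · obtain ⟨b, hb, h⟩ := touch x₂ x₃ s2 s3 (by rw [real_inner_comm, i23])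
      have hbK : b ∈ K := hBK (Or.inl (Or.inr hb))
      exact ⟨b, hbK, hKs b hbK, h, hK2 b hbK⟩
    · rw [breadth_eq hn2 hn3 hne1 hne2, gdist_of_cos hr0.le (by linarith)
        (by rw [inner_neg_neg, i23])]
  · rintro b ⟨u, v, ⟨hu, hv, h1, h2, hsub, -, -⟩, rfl⟩
    rw [breadth_eq hu hv h1 h2]
    have hpol : ∀ u, u ∈ unitSphere 2 → (∀ x ∈ K, ⟪x, u⟫ ≤ 0) →
        Real.cos r ≤ ⟪-u, x₁⟫ ∧ Real.cos r ≤ ⟪-u, x₂⟫ ∧ Real.cos r ≤ ⟪-u, x₃⟫ := by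
      intro u hu h
      have g1 := gball_polar s1 hu (ρ := π / 2 - r) (by linarith) (by linarith)
        (fun b hb => h b (hBK (Or.inl (Or.inl hb))))
      have g2 := gball_polar s2 hu (ρ := π / 2 - r) (by linarith) (by linarith)
        (fun b hb => h b (hBK (Or.inl (Or.inr hb))))
      have g3 := gball_polar s3 hu (ρ := π / 2 - r) (by linarith) (by linarith)
        (fun b hb => h b (hBK (Or.inr hb)))
      rw [Real.sin_pi_div_two_sub] at g1 g2 g3
      simp only [inner_neg_left]
      exact ⟨by linarith, by linarith, by linarith⟩
    obtain ⟨u1, u2, u3⟩ := hpol u hu (fun x hx => (hsub hx).2.1)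
    obtain ⟨v1, v2, v3⟩ := hpol v hv (fun x hx => (hsub hx).2.2)
    have := reuleaux_diam hr0 hr1 G.hx (us_neg hu) (us_neg hv) u1 u2 u3 v1 v2 v3
    rw [inner_neg_neg, ← gdist_le_iff hu hv hr0.le (by linarith)] at this
    linarith

theorem cos_mvt {x y : ℝ} (h : x < y) :
    ∃ ξ ∈ Set.Ioo x y, Real.cos x - Real.cos y = Real.sin ξ * (y - x) := by
  obtain ⟨ξ, hξ, h'⟩ := exists_hasDerivAt_eq_slope Real.cos (fun t => -Real.sin t) h
    Real.continuous_cos.continuousOn (fun t _ => Real.hasDerivAt_cos t)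
  refine ⟨ξ, hξ, ?_⟩
  have : y - x ≠ 0 := by linarith
  field_simp at h'
  linarith

theorem cfg_R_unique {R' : ℝ} {c' e' f' x₁' x₂' x₃' : E 2} (G : Cfg r R c e f x₁ x₂ x₃)
    (G' : Cfg r R' c' e' f' x₁' x₂' x₃') : R' = R := by
  have h1 := G.hcos
  have h2 := G'.hcos
  rw [Real.sin_sq] at h1 h2
  have h3 : Real.cos R' ^ 2 = Real.cos R ^ 2 := by linarith
  have h4 := (pow_left_inj₀ G'.cosR.le G.cosR.le two_ne_zero).1 h3
  exact Real.injOn_cos ⟨G'.hR0.le, G'.Rpi⟩ ⟨G.hR0.le, G.Rpi⟩ h4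

theorem Cfg.polar_sub (G : Cfg r R c e f x₁ x₂ x₃) {p : E 2}
    (hp : p ∈ polar (gball x₁ r ∩ gball x₂ r ∩ gball x₃ r)) :
    gdist (-c) p ≤ R + π / 2 - r := by
  have hr0 := G.hr0
  have hr1 := G.hr1
  have hR0 := G.hR0
  have hRr := G.hRr
  obtain ⟨s1, s2, s3, -⟩ := G.hx
  have h := gball_polar G.cs hp.1 (ρ := r - R) (by linarith) (by linarith) (by
    intro b hb
    refine hp.2 b ⟨⟨?_, ?_⟩, ?_⟩
    · refine ⟨hb.1, ?_⟩
      have := gdist_tri s1 G.cs hb.1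
      rw [gdist_comm x₁ c, gdist_of_cos hR0.le G.Rpi G.c1] at this
      linarith [hb.2]
    · refine ⟨hb.1, ?_⟩
      have := gdist_tri s2 G.cs hb.1
      rw [gdist_comm x₂ c, gdist_of_cos hR0.le G.Rpi G.c2] at this
      linarith [hb.2]
    · refine ⟨hb.1, ?_⟩
      have := gdist_tri s3 G.cs hb.1
      rw [gdist_comm x₃ c, gdist_of_cos hR0.le G.Rpi G.c3] at this
      linarith [hb.2])
  rw [gdist_le_iff (us_neg G.cs) hp.1 (by linarith) (by linarith), inner_neg_left,
    show R + π / 2 - r = π / 2 - (r - R) by ring, Real.cos_pi_div_two_sub, real_inner_comm]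
  linarith

theorem haus_ge {A B : Set (E n)} {x : E n} (hx : x ∈ A) : sdist x B ≤ hausdorffG A B := by
  refine le_trans (le_csSup ?_ (Set.mem_image_of_mem (fun x => sdist x B) hx)) (le_max_left _ _)
  refine ⟨π, ?_⟩
  rintro _ ⟨z, -, rfl⟩
  rcases B.eq_empty_or_nonempty with h | ⟨b, hb⟩
  · subst h; simp [sdist, Real.pi_pos.le]
  · exact (csInf_le ⟨0, by rintro _ ⟨z, -, rfl⟩; exact gdist_nonneg _ _⟩
      (Set.mem_image_of_mem (gdist z) hb)).trans
      (gdist_le_pi _ _)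

theorem haus_nonneg {A B : Set (E n)} : 0 ≤ hausdorffG A B := by
  refine le_trans ?_ (le_max_left _ _)
  refine Real.sSup_nonneg ?_
  rintro _ ⟨z, -, rfl⟩
  refine Real.sInf_nonneg ?_
  rintro _ ⟨z, -, rfl⟩
  exact gdist_nonneg _ _

theorem Cfg.haus_part (G : Cfg r R c e f x₁ x₂ x₃) {y : E 2} {ε σ : ℝ} (hε : 0 < ε)
    (hσ : σ = R + π / 2 - r) (hσε : σ + ε ≤ π / 2)
    (hy : y = Real.cos (σ + ε) • c + Real.sin (σ + ε) • e + (0 : ℝ) • f)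
    {U : Set (E 2)} (hU : IsReuleaux U r) :
    Real.sin σ ^ 2 / 3 * ε ≤ hausdorffG (sconv (sconv (balls r x₁ x₂ x₃) ∪ {y})) (polar U) := by
  have hr0 := G.hr0
  have hr1 := G.hr1
  have hR0 := G.hR0
  have hRr := G.hRr
  have hpi := Real.pi_pos
  obtain ⟨s1, s2, s3, -⟩ := G.hx
  obtain ⟨x₁', x₂', x₃', hx', rfl⟩ := hU
  obtain ⟨R', c', e', f', G'⟩ := cfg_exists hr0 hr1 hx'
  have hRR := cfg_R_unique G G'
  subst hRR
  set η := hausdorffG (sconv (sconv (balls r x₁ x₂ x₃) ∪ {y}))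
    (polar (gball x₁' r ∩ gball x₂' r ∩ gball x₃' r)) with hη
  have hη0 : 0 ≤ η := haus_nonneg
  have hσ0 : 0 < σ := by linarith
  have hsσ : 0 < Real.sin σ := Real.sin_pos_of_pos_of_lt_pi hσ0 (by linarith)
  have hs1 := Real.sin_le_one σ
  rcases le_or_gt ε η with hle | hlt
  · have : Real.sin σ ^ 2 / 3 ≤ 1 := by nlinarith only [hsσ, hs1]
    nlinarith only [this, hε, hle]
  have hys : y ∈ unitSphere 2 := us_of_inner (by
    rw [hy, G.F.inner]; linear_combination Real.sin_sq_add_cos_sq (σ + ε))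
  have hcs := us_neg G'.cs
  have near : ∀ p ∈ sconv (sconv (balls r x₁ x₂ x₃) ∪ {y}), p ∈ unitSphere 2 →
      Real.cos (σ + η) ≤ ⟪p, -c'⟫ := by
    intro p hp hps
    have h1 := haus_ge (B := polar (gball x₁' r ∩ gball x₂' r ∩ gball x₃' r)) hp
    rw [← hη] at h1
    have h2 : gdist p (-c') - σ ≤
        sdist p (polar (gball x₁' r ∩ gball x₂' r ∩ gball x₃' r)) := by
      refine le_csInf ?_ ?_
      · refine ⟨_, -x₁', ⟨us_neg hx'.1, ?_⟩, rfl⟩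
        intro b hb
        rw [inner_neg_right]
        have hb1 := hb.1.1
        have := (gdist_le_iff hx'.1 hb1.1 hr0.le (by linarith)).1 hb1.2
        rw [real_inner_comm] at this
        linarith [G.cosr]
      · rintro _ ⟨q, hq, rfl⟩
        have h3 := gdist_tri hps hq.1 hcs
        have h4 := G'.polar_sub hq
        rw [gdist_comm q] at h3
        linarith
    rw [← gdist_le_iff hps hcs (by linarith) (by linarith)]
    linarith
  set m2 : E 2 := Real.cos σ • c + (-(Real.sin σ / 2)) • e + (Real.sin σ * (√3 / 2)) • f with hm2
  set m3 : E 2 := Real.cos σ • c + (-(Real.sin σ / 2)) • e + (-(Real.sin σ * (√3 / 2))) • f with hm3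
  have h3 : √3 ^ 2 = 3 := Real.sq_sqrt (by norm_num)
  have m2s : m2 ∈ unitSphere 2 := us_of_inner (by
    rw [hm2, G.F.inner]
    linear_combination Real.sin_sq_add_cos_sq σ + Real.sin σ ^ 2 / 4 * h3)
  have m3s : m3 ∈ unitSphere 2 := us_of_inner (by
    rw [hm3, G.F.inner]
    linear_combination Real.sin_sq_add_cos_sq σ + Real.sin σ ^ 2 / 4 * h3)
  have hcρ : Real.cos (π / 2 - r) = Real.cos σ * Real.cos R' + Real.sin σ * Real.sin R' := by
    rw [← Real.cos_sub]; congr 1; rw [hσ]; ring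
  have m2b : m2 ∈ gball x₂ (π / 2 - r) := by
    refine ⟨m2s, ?_⟩
    rw [gdist_le_iff s2 m2s (by linarith) (by linarith), hcρ, G.e2, hm2, G.F.inner]
    apply le_of_eq
    linear_combination (-Real.sin R' * Real.sin σ / 4) * h3
  have m3b : m3 ∈ gball x₃ (π / 2 - r) := by
    refine ⟨m3s, ?_⟩
    rw [gdist_le_iff s3 m3s (by linarith) (by linarith), hcρ, G.e3, hm3, G.F.inner]
    apply le_of_eq
    linear_combination (-Real.sin R' * Real.sin σ / 4) * h3
  have n1 := near y (subset_sconv' _ (Or.inr rfl)) hys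
  have n2 := near m2 (subset_sconv' _ (Or.inl (subset_sconv' _ (Or.inl (Or.inr m2b))))) m2s
  have n3 := near m3 (subset_sconv' _ (Or.inl (subset_sconv' _ (Or.inr m3b)))) m3s
  have hcc := (inner_bd G.cs hcs).2
  have hsum : Real.sin σ * ⟪y, -c'⟫ + Real.sin (σ + ε) * (⟪m2, -c'⟫ + ⟪m3, -c'⟫) =
      (Real.sin σ * Real.cos (σ + ε) + 2 * Real.cos σ * Real.sin (σ + ε)) * ⟪c, -c'⟫ := by
    rw [hy, hm2, hm3]
    simp only [inner_add_left, real_inner_smul_left]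
    ring
  have hse : 0 < Real.sin (σ + ε) := Real.sin_pos_of_pos_of_lt_pi (by linarith) (by linarith)
  have hce : 0 ≤ Real.cos (σ + ε) := Real.cos_nonneg_of_mem_Icc ⟨by linarith, hσε⟩
  have hcσ : 0 ≤ Real.cos σ := Real.cos_nonneg_of_mem_Icc ⟨by linarith, by linarith⟩
  have hbr : 0 ≤ Real.sin σ * Real.cos (σ + ε) + 2 * Real.cos σ * Real.sin (σ + ε) := by
    positivity
  have k1 := mul_le_mul_of_nonneg_left hcc hbr
  have k2 := mul_le_mul_of_nonneg_left n1 hsσ.le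
  have k3 := mul_le_mul_of_nonneg_left (add_le_add n2 n3) hse.le
  have k4 : Real.sin σ * (Real.cos (σ + η) - Real.cos (σ + ε)) ≤
      2 * Real.sin (σ + ε) * (Real.cos σ - Real.cos (σ + η)) := by linarith
  have k5 : Real.sin σ * (ε - η) ≤ Real.cos (σ + η) - Real.cos (σ + ε) := by
    obtain ⟨ξ, hξ, h⟩ := cos_mvt (show σ + η < σ + ε by linarith)
    rw [h]
    have : Real.sin σ ≤ Real.sin ξ :=
      Real.sin_le_sin_of_le_of_le_pi_div_two (by linarith) (by linarith [hξ.2])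
        (by linarith [hξ.1])
    have h2 := mul_le_mul_of_nonneg_right this (show 0 ≤ ε - η by linarith only [hlt])
    linarith only [h2]
  have k6 : Real.cos σ - Real.cos (σ + η) ≤ η := by
    rcases hη0.eq_or_lt with h0 | h0
    · rw [← h0]; simp
    obtain ⟨ξ, hξ, h⟩ := cos_mvt (show σ < σ + η by linarith)
    rw [h]
    have h2 := mul_le_mul_of_nonneg_right (Real.sin_le_one ξ) hη0
    linarith only [h2]
  have k7 := mul_le_mul_of_nonneg_left k5 hsσ.le
  have k8 : 2 * Real.sin (σ + ε) * (Real.cos σ - Real.cos (σ + η)) ≤ 2 * η := by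
    have := mul_le_mul_of_nonneg_left k6 (show 0 ≤ 2 * Real.sin (σ + ε) by positivity)
    have h2 := mul_le_mul_of_nonneg_right (Real.sin_le_one (σ + ε)) hη0
    linarith only [this, h2]
  have k9 : Real.sin σ ^ 2 ≤ 1 := by nlinarith only [hsσ, hs1]
  have k10 : Real.sin σ ^ 2 * η ≤ 1 * η := mul_le_mul_of_nonneg_right k9 hη0
  have k11 : Real.sin σ * (Real.sin σ * (ε - η)) = Real.sin σ ^ 2 * ε - Real.sin σ ^ 2 * η := by
    ring
  linarith only [k4, k7, k8, k10, k11]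

theorem Cfg.frame1 (G : Cfg r R c e f x₁ x₂ x₃) :
    Frame x₁ ((-Real.sin R) • c + Real.cos R • e + (0 : ℝ) • f) f := by
  have h := Real.sin_sq_add_cos_sq R
  have hf : f = (0 : ℝ) • c + (0 : ℝ) • e + (1 : ℝ) • f := by simp
  refine ⟨us_inner G.hx.1, ?_, G.F.ff, ?_, ?_, ?_⟩
  · rw [G.F.inner]; linear_combination h
  · rw [G.e1, G.F.inner]; ring
  · rw [G.e1]
    simp only [inner_add_left, real_inner_smul_left, G.F.cf, G.F.ef]; ring
  · simp only [inner_add_left, real_inner_smul_left, G.F.cf, G.F.ef]; ring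

theorem Cfg.y_pos (G : Cfg r R c e f x₁ x₂ x₃) {z m₁ y : E 2} {ε : ℝ}
    (hz : z ∈ seg x₂ x₃ ∧ gdist x₂ z = gdist x₃ z)
    (hm : m₁ ∈ unitSphere 2 ∧ gdist x₁ m₁ = π / 2 - r ∧ x₁ ∈ seg z m₁)
    (hy : y ∈ unitSphere 2) (hmy : gdist m₁ y = ε) (hmseg : m₁ ∈ seg x₁ y) :
    y = Real.cos (π / 2 - r + ε) • x₁ +
      Real.sin (π / 2 - r + ε) • ((-Real.sin R) • c + Real.cos R • e + (0 : ℝ) • f) := by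
  have hr0 := G.hr0
  have hr1 := G.hr1
  have hpi := Real.pi_pos
  obtain ⟨i12, i23, i13⟩ := G.inners
  obtain ⟨s1, s2, s3, d12, d23, d13⟩ := G.hx
  have F1 := G.frame1
  have hsR := G.sinR
  have hcR := G.cosR
  set g : E 2 := (-Real.sin R) • c + Real.cos R • e + (0 : ℝ) • f with hg
  -- the midpoint z
  have hz1 : gdist x₂ z = r / 2 := by
    have := hz.1.2
    rw [gdist_comm z x₃, ← hz.2, d23] at this; linarith
  have hz2 : gdist z x₃ = r / 2 := by rw [gdist_comm, ← hz.2, hz1]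
  have hzs := slerp s2 s3 hz.1
  rw [hz1, hz2, d23] at hzs
  have hzS := hz.1.1
  have hsr2 : 0 < Real.sin (r / 2) := Real.sin_pos_of_pos_of_lt_pi (by linarith) (by linarith)
  have hcr2 : 0 < Real.cos (r / 2) := Real.cos_pos_of_mem_Ioo ⟨by linarith, by linarith⟩
  have hsr := G.sinr
  have hcr := G.cosr
  have hzx1 : Real.sin r * ⟪z, x₁⟫ = 2 * Real.sin (r / 2) * Real.cos r := by
    rw [← real_inner_smul_left, hzs, inner_add_left, real_inner_smul_left, real_inner_smul_left,
      real_inner_comm, i12, real_inner_comm, i13]; ring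
  have hx2g : ⟪x₂, g⟫ = -(3 / 2 * Real.sin R * Real.cos R) := by
    rw [G.e2, hg, G.F.inner]; ring
  have hx3g : ⟪x₃, g⟫ = -(3 / 2 * Real.sin R * Real.cos R) := by
    rw [G.e3, hg, G.F.inner]; ring
  have hzg : Real.sin r * ⟪z, g⟫ = -(3 * Real.sin (r / 2) * Real.sin R * Real.cos R) := by
    rw [← real_inner_smul_left, hzs, inner_add_left, real_inner_smul_left, real_inner_smul_left,
      hx2g, hx3g]; ring
  have hx2f : ⟪x₂, f⟫ = Real.sin R * (√3 / 2) := by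
    rw [G.e2]; simp only [inner_add_left, real_inner_smul_left, G.F.cf, G.F.ef, G.F.ff]; ring
  have hx3f : ⟪x₃, f⟫ = -(Real.sin R * (√3 / 2)) := by
    rw [G.e3]; simp only [inner_add_left, real_inner_smul_left, G.F.cf, G.F.ef, G.F.ff]; ring
  have hzf : ⟪z, f⟫ = 0 := by
    have : Real.sin r * ⟪z, f⟫ = 0 := by
      rw [← real_inner_smul_left, hzs, inner_add_left, real_inner_smul_left,
        real_inner_smul_left, hx2f, hx3f]; ring
    exact (mul_eq_zero.1 this).resolve_left hsr.ne'
  have hze := F1.expand z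
  rw [hzf] at hze
  set p := ⟪z, x₁⟫ with hp
  set q := ⟪z, g⟫ with hq
  have hqneg : q < 0 := by
    have : 0 < 3 * Real.sin (r / 2) * Real.sin R * Real.cos R := by positivity
    by_contra hcon
    push Not at hcon
    have := mul_nonneg hsr.le hcon
    linarith
  have hpq : p ^ 2 + q ^ 2 = 1 := by
    have := us_inner hzS
    rw [hze, F1.inner] at this; linarith
  set H := gdist z x₁ with hH
  have hcH : Real.cos H = p := cos_gdist hzS s1
  have hsH : Real.sin H = -q := by
    have a1 : 0 ≤ Real.sin H :=
      Real.sin_nonneg_of_nonneg_of_le_pi (gdist_nonneg _ _) (gdist_le_pi _ _)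
    refine (pow_left_inj₀ a1 (by linarith) two_ne_zero).1 ?_
    rw [Real.sin_sq, hcH]; linarith
  -- the point m
  set ρ := π / 2 - r with hρ
  have hsl := slerp hzS hm.1 hm.2.2
  have hdzm : gdist z m₁ = H + ρ := by rw [← hm.2.2.2, hm.2.1]
  rw [hdzm, hm.2.1, ← hH, Real.sin_add, hsH, hcH] at hsl
  have hmm : m₁ = Real.cos ρ • x₁ + Real.sin ρ • g := by
    have h1 : (-q) • m₁ = (-q) • (Real.cos ρ • x₁ + Real.sin ρ • g) := by
      have : (-q) • m₁ = (-q * Real.cos ρ + p * Real.sin ρ) • x₁ - Real.sin ρ • z := by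
        rw [hsl]; module
      rw [this, hze]; module
    exact smul_right_injective _ (show -q ≠ 0 by linarith) h1
  -- the point y
  have hsρ : 0 < Real.sin ρ := Real.sin_pos_of_pos_of_lt_pi (by linarith) (by linarith)
  have hsy := slerp s1 hy hmseg
  have hdxy : gdist x₁ y = ρ + ε := by rw [← hmseg.2, hm.2.1, hmy]
  rw [hdxy, hmy, hm.2.1, hmm] at hsy
  have h1 : Real.sin ρ • y = Real.sin ρ • (Real.cos (ρ + ε) • x₁ + Real.sin (ρ + ε) • g) := by
    have h2 : Real.sin ρ • y = Real.sin (ρ + ε) • (Real.cos ρ • x₁ + Real.sin ρ • g) -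
        Real.sin ε • x₁ := by rw [hsy]; module
    have h3 : Real.sin ε = Real.sin (ρ + ε) * Real.cos ρ - Real.cos (ρ + ε) * Real.sin ρ := by
      rw [← Real.sin_sub]; congr 1; ring
    rw [h2, h3]; module
  exact smul_right_injective _ hsρ.ne' h1

theorem sconv_comb3 {u : E n} (he : u ∈ unitSphere n) {X : Set (E n)}
    (hX : ∀ x ∈ X, x ∈ unitSphere n ∧ 0 < ⟪u, x⟫) {x y z p : E n} (hx : x ∈ sconv X)
    (hy : y ∈ sconv X) (hz : z ∈ sconv X) (hp : p ∈ unitSphere n) {α β γ : ℝ} (hα : 0 ≤ α)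
    (hβ : 0 ≤ β) (hγ : 0 ≤ γ) (h : p = α • x + β • y + γ • z) : p ∈ sconv X := by
  set v : E n := β • y + γ • z with hv
  have hpv : p = α • x + v := by rw [h, hv]; module
  by_cases hv0 : v = 0
  · exact sconv_comb he hX hx hx hp hα le_rfl (by rw [hpv, hv0]; simp)
  · have hn : 0 < ‖v‖ := norm_pos_iff.2 hv0
    have hvm : ‖v‖⁻¹ • v ∈ sconv X := by
      refine sconv_comb he hX hy hz ?_ (α := ‖v‖⁻¹ * β) (β := ‖v‖⁻¹ * γ)
          (by positivity) (by positivity) ?_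
      · rw [us_iff, norm_smul, norm_inv, norm_norm, inv_mul_cancel₀ hn.ne']
      · rw [hv]; module
    refine sconv_comb he hX hx hvm hp hα hn.le ?_
    rw [smul_smul, mul_inv_cancel₀ hn.ne', one_smul]; exact hpv

theorem arctan_abs_le {v q : ℝ} (h : |v| ≤ q) : |Real.arctan v| ≤ q := by
  have key : ∀ v : ℝ, 0 ≤ v → Real.arctan v ≤ v := by
    intro v hv
    rcases hv.eq_or_lt with h0 | h0
    · rw [← h0]; simp
    · have := Real.lt_tan (Real.arctan_pos.2 h0) (Real.arctan_lt_pi_div_two v)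
      rw [Real.tan_arctan] at this
      exact this.le
  rw [abs_le] at h ⊢
  rcases le_total 0 v with hv | hv
  · exact ⟨by linarith [Real.arctan_nonneg.2 hv], by linarith [key v hv]⟩
  · have h1 := key (-v) (by linarith)
    rw [Real.arctan_neg] at h1
    have : Real.arctan v ≤ 0 := by
      have := Real.arctan_nonneg.2 (show 0 ≤ -v by linarith)
      rw [Real.arctan_neg] at this; linarith
    exact ⟨by linarith, by linarith⟩

theorem polar_coords {X Y Z q : ℝ} (h : X ^ 2 + Y ^ 2 + Z ^ 2 = 1) (hY : 0 < Y)
    (hZ : |Z| ≤ q * Y) : ∃ s : ℝ, |s| ≤ q ∧ Y = Real.sin (Real.arccos X) * Real.cos s ∧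
      Z = Real.sin (Real.arccos X) * Real.sin s := by
  have hc := Real.cos_arctan_pos (Z / Y)
  have ht := Real.tan_arctan (Z / Y)
  have hq : |Real.arctan (Z / Y)| ≤ q := by
    apply arctan_abs_le
    rw [abs_div, abs_of_pos hY, div_le_iff₀ hY]; exact hZ
  set s := Real.arctan (Z / Y)
  rw [Real.tan_eq_sin_div_cos, div_eq_div_iff hc.ne' hY.ne'] at ht
  have hs : Real.sin (Real.arccos X) = Y / Real.cos s := by
    rw [Real.sin_arccos]
    have : 1 - X ^ 2 = (Y / Real.cos s) ^ 2 := by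
      field_simp
      linear_combination (-Real.cos s ^ 2) * h - (Real.sin s * Y + Z * Real.cos s) * ht
        + Y ^ 2 * Real.sin_sq_add_cos_sq s
    rw [this, Real.sqrt_sq (by positivity)]
  refine ⟨s, hq, ?_, ?_⟩
  · rw [hs]; field_simp
  · rw [hs]; field_simp; linarith

/-- a small polar rectangle -/
def prect (x g f : E 2) (ρ ε q : ℝ) : Set (E 2) :=
  {p | ∃ t s : ℝ, ρ ≤ t ∧ t ≤ ρ + ε ∧ |s| ≤ q ∧
    p = Real.cos t • x + (Real.sin t * Real.cos s) • g + (Real.sin t * Real.sin s) • f}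

theorem le_abs_of_sq {a M : ℝ} (h0 : 0 ≤ a) (h : a ^ 2 ≤ M ^ 2) : a ≤ |M| := by
  have := sq_le_sq.1 h
  rwa [abs_of_nonneg h0] at this

theorem prect_area {x g f : E 2} (F : Frame x g f) {ρ ε q : ℝ} (hε : 0 ≤ ε) (hq : 0 ≤ q) :
    μH[2] (prect x g f ρ ε q) ≤ ENNReal.ofReal (8 * q * ε) := by
  set φ : (Fin 2 → ℝ) → E 2 := fun v => Real.cos (v 0) • x +
    (Real.sin (v 0) * Real.cos (v 1)) • g + (Real.sin (v 0) * Real.sin (v 1)) • f with hφ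
  have hcos : ∀ x : ℝ, 2 - 2 * Real.cos x ≤ x ^ 2 := fun x => by
    linarith [Real.one_sub_sq_div_two_le_cos (x := x)]
  have hnorm : ∀ a b d M : ℝ, a ^ 2 + b ^ 2 + d ^ 2 ≤ M ^ 2 →
      ‖a • x + b • g + d • f‖ ≤ |M| := by
    intro a b d M h
    apply le_abs_of_sq (norm_nonneg _)
    rw [← real_inner_self_eq_norm_sq, F.inner]; linarith
  have hL : LipschitzWith 2 φ := by
    apply LipschitzWith.of_dist_le_mul
    intro v v'
    have d0 : |v 0 - v' 0| ≤ dist v v' := by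
      have := dist_le_pi_dist v v' 0
      rwa [Real.dist_eq] at this
    have d1 : |v 1 - v' 1| ≤ dist v v' := by
      have := dist_le_pi_dist v v' 1
      rwa [Real.dist_eq] at this
    have e0 : φ v - φ v' = ((Real.cos (v 0) - Real.cos (v' 0)) • x +
        (Real.sin (v 0) * Real.cos (v 1) - Real.sin (v' 0) * Real.cos (v 1)) • g +
        (Real.sin (v 0) * Real.sin (v 1) - Real.sin (v' 0) * Real.sin (v 1)) • f) +
        ((0 : ℝ) • x +
        (Real.sin (v' 0) * Real.cos (v 1) - Real.sin (v' 0) * Real.cos (v' 1)) • g +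
        (Real.sin (v' 0) * Real.sin (v 1) - Real.sin (v' 0) * Real.sin (v' 1)) • f) := by
      rw [hφ]; module
    rw [dist_eq_norm, e0]
    refine (norm_add_le _ _).trans ?_
    have n1 := hnorm (Real.cos (v 0) - Real.cos (v' 0))
      (Real.sin (v 0) * Real.cos (v 1) - Real.sin (v' 0) * Real.cos (v 1))
      (Real.sin (v 0) * Real.sin (v 1) - Real.sin (v' 0) * Real.sin (v 1)) (v 0 - v' 0) (by
        have h1 := hcos (v 0 - v' 0)
        rw [Real.cos_sub] at h1
        refine le_trans (le_of_eq ?_) h1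
        linear_combination (Real.sin (v 0) - Real.sin (v' 0)) ^ 2 *
          Real.sin_sq_add_cos_sq (v 1) + Real.sin_sq_add_cos_sq (v 0) +
          Real.sin_sq_add_cos_sq (v' 0))
    have n2 := hnorm 0
      (Real.sin (v' 0) * Real.cos (v 1) - Real.sin (v' 0) * Real.cos (v' 1))
      (Real.sin (v' 0) * Real.sin (v 1) - Real.sin (v' 0) * Real.sin (v' 1)) (v 1 - v' 1) (by
        have h1 := hcos (v 1 - v' 1)
        rw [Real.cos_sub] at h1
        have h2 : Real.sin (v' 0) ^ 2 ≤ 1 := Real.sin_sq_le_one _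
        have h3 : 0 ≤ 2 - 2 * (Real.cos (v 1) * Real.cos (v' 1) +
            Real.sin (v 1) * Real.sin (v' 1)) := by
          rw [← Real.cos_sub]; linarith [Real.cos_le_one (v 1 - v' 1)]
        have h4 := mul_le_mul_of_nonneg_right h2 h3
        refine le_trans (le_of_eq ?_) (h4.trans (by rw [one_mul]; exact h1))
        linear_combination Real.sin (v' 0) ^ 2 * (Real.sin_sq_add_cos_sq (v 1) +
          Real.sin_sq_add_cos_sq (v' 1)))
    have : ((2 : NNReal) : ℝ) = 2 := rfl
    rw [this]
    linarith
  have hsub : prect x g f ρ ε q ⊆ φ '' Set.Icc ![ρ, -q] ![ρ + ε, q] := by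
    rintro p ⟨t, s, h1, h2, h3, rfl⟩
    rw [abs_le] at h3
    refine ⟨![t, s], ⟨?_, ?_⟩, by simp [hφ]⟩
    · intro i; fin_cases i
      · simpa using h1
      · simpa using h3.1
    · intro i; fin_cases i
      · simpa using h2
      · simpa using h3.2
  refine (measure_mono hsub).trans ((hL.hausdorffMeasure_image_le (by norm_num) _).trans ?_)
  have hv : (μH[2] : Measure (Fin 2 → ℝ)) = volume := by
    have := hausdorffMeasure_pi_real (ι := Fin 2)
    simpa using this
  rw [hv, Real.volume_Icc_pi, Fin.prod_univ_two]
  simp only [Matrix.cons_val_zero, Matrix.cons_val_one]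
  rw [← ENNReal.ofReal_mul (by linarith)]
  have : ((2 : NNReal) : ENNReal) ^ (2 : ℝ) = ENNReal.ofReal 4 := by
    rw [show (2 : ℝ) = ((2 : ℕ) : ℝ) by norm_num, ENNReal.rpow_natCast]
    rw [show ((2 : NNReal) : ENNReal) = ENNReal.ofReal 2 by simp,
      ← ENNReal.ofReal_pow (by norm_num)]
    norm_num
  rw [this, ← ENNReal.ofReal_mul (by norm_num)]
  apply ENNReal.ofReal_le_ofReal
  apply le_of_eq; ring

set_option maxHeartbeats 1000000 in
theorem region {x g f c y : E 2} (F : Frame x g f) (hc : c ∈ unitSphere 2) {X : Set (E 2)}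
    (hX : ∀ b ∈ X, b ∈ unitSphere 2 ∧ 0 < ⟪c, b⟫) {ρ ε κ τ : ℝ} (hρ : 0 < ρ) (hε : 0 < ε)
    (hρε : ρ + ε < π / 2) (hκ : 0 < κ) (hτ : 0 < τ) (hκτ : κ ^ 2 + τ ^ 2 = 1)
    (hk : Real.cos ρ * Real.sin (ρ + ε) * κ = Real.sin ρ * Real.cos (ρ + ε))
    (hy : y = Real.cos (ρ + ε) • x + Real.sin (ρ + ε) • g + (0 : ℝ) • f) (hcy : 0 < ⟪c, y⟫)
    (hball : gball x ρ ⊆ X)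
    (hu : ∀ b ∈ X, ⟪b, (-Real.sin ρ) • x + (Real.cos ρ * κ) • g + (Real.cos ρ * τ) • f⟫ ≤ 0)
    (hv : ∀ b ∈ X, ⟪b, (-Real.sin ρ) • x + (Real.cos ρ * κ) • g + (-(Real.cos ρ * τ)) • f⟫ ≤ 0) :
    sconv (sconv X ∪ {y}) \ sconv X ⊆ prect x g f ρ ε (τ / κ) := by
  have hpi := Real.pi_pos
  have hP : 0 < Real.sin ρ := Real.sin_pos_of_pos_of_lt_pi hρ (by linarith)
  have hQ : 0 < Real.cos ρ := Real.cos_pos_of_mem_Ioo ⟨by linarith, by linarith⟩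
  have hS : 0 < Real.sin (ρ + ε) := Real.sin_pos_of_pos_of_lt_pi (by linarith) (by linarith)
  have hC : 0 < Real.cos (ρ + ε) := Real.cos_pos_of_mem_Ioo ⟨by linarith, by linarith⟩
  have hCQ : Real.cos (ρ + ε) ≤ Real.cos ρ :=
    Real.cos_le_cos_of_nonneg_of_le_pi hρ.le (by linarith) (by linarith)
  have hPQ := Real.sin_sq_add_cos_sq ρ
  have hSC := Real.sin_sq_add_cos_sq (ρ + ε)
  have hxs : x ∈ unitSphere 2 := us_of_inner F.cc
  have hyy : ⟪y, y⟫ = 1 := by rw [hy, F.inner]; linarith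
  have hys : y ∈ unitSphere 2 := us_of_inner hyy
  have acQ : Real.arccos (Real.cos ρ) = ρ := Real.arccos_cos hρ.le (by linarith)
  have acC : Real.arccos (Real.cos (ρ + ε)) = ρ + ε :=
    Real.arccos_cos (by linarith) (by linarith)
  have tmem : ∀ τ' : ℝ, κ ^ 2 + τ' ^ 2 = 1 →
      Real.cos ρ • x + (Real.sin ρ * κ) • g + (Real.sin ρ * τ') • f ∈ gball x ρ := by
    intro τ' h
    have hs : Real.cos ρ • x + (Real.sin ρ * κ) • g + (Real.sin ρ * τ') • f ∈ unitSphere 2 := by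
      apply us_of_inner
      rw [F.inner]; linear_combination hPQ + Real.sin ρ ^ 2 * h
    refine ⟨hs, ?_⟩
    rw [gdist_le_iff hxs hs hρ.le (by linarith)]
    simp only [inner_add_right, real_inner_smul_right, F.cc, F.ce, F.cf]
    linarith
  have ht1 := subset_sconv' X (hball (tmem τ hκτ))
  have ht2 := subset_sconv' X (hball (tmem (-τ) (by linarith [neg_sq τ])))
  generalize hP' : Real.sin ρ = P at *
  generalize hQ' : Real.cos ρ = Q at *
  generalize hS' : Real.sin (ρ + ε) = S at *
  generalize hC' : Real.cos (ρ + ε) = C at *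
  rintro p ⟨hpK, hp0⟩
  have hXne : X.Nonempty := ⟨_, hball (tmem τ hκτ)⟩
  have hps : p ∈ unitSphere 2 := by
    refine (sconv_hemi hc (X := sconv X ∪ {y}) ?_ hpK).1
    rintro b (hb | hb)
    · exact sconv_hemi hc hX hb
    · rw [Set.mem_singleton_iff.1 hb]; exact ⟨hys, hcy⟩
  obtain ⟨α, β, k, hkK, hα, hβ, hp⟩ := sconv_point hc hXne hX hys hcy hpK
  have ku := sconv_half hc hX hu hkK
  have kv := sconv_half hc hX hv hkK
  have hke := F.expand k
  generalize ⟪k, x⟫ = kx at *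
  generalize ⟪k, g⟫ = ky at *
  generalize ⟪k, f⟫ = kz at *
  rw [hke, F.inner] at ku kv
  set t₁ : E 2 := Q • x + (P * κ) • g + (P * τ) • f with ht₁
  set t₂ : E 2 := Q • x + (P * κ) • g + (P * -τ) • f with ht₂
  obtain ⟨B, hB⟩ : ∃ B, B = (P * kx - Q * κ * ky + Q * τ * kz) / (2 * P * Q * τ ^ 2) := ⟨_, rfl⟩
  obtain ⟨D, hD⟩ : ∃ D, D = (P * kx - Q * κ * ky - Q * τ * kz) / (2 * P * Q * τ ^ 2) := ⟨_, rfl⟩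
  obtain ⟨A, hA⟩ : ∃ A, A = (ky - P * κ * (B + D)) / S := ⟨_, rfl⟩
  have hB0 : 0 ≤ B := by rw [hB]; apply div_nonneg _ (by positivity); linarith
  have hD0 : 0 ≤ D := by rw [hD]; apply div_nonneg _ (by positivity); linarith
  have hkdec : k = A • y + B • t₁ + D • t₂ := by
    have e2 : A * S + P * κ * (B + D) = ky := by rw [hA]; field_simp; ring
    have e3 : P * τ * (B - D) = kz := by rw [hB, hD]; field_simp; ring
    have e4 : P * Q * τ ^ 2 * (B + D) = P * kx - Q * κ * ky := by
      rw [hB, hD]; field_simp; ring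
    have e1 : A * C + Q * (B + D) = kx := by
      have : P * (A * C + Q * (B + D)) = P * kx := by
        linear_combination Q * κ * e2 + e4 - A * hk - P * Q * (B + D) * hκτ
      exact mul_left_cancel₀ hP.ne' this
    rw [hke, hy, ht₁, ht₂, ← e1, ← e2, ← e3]; module
  by_cases hneg : α * A + β < 0
  · exfalso
    apply hp0
    have hAneg : A < 0 := by
      by_contra hcon
      push Not at hcon
      nlinarith [mul_nonneg hα hcon]
    refine sconv_comb3 hc hX hkK ht1 ht2 hps (α := α - β / (-A)) (β := β / (-A) * B)
      (γ := β / (-A) * D) ?_ ?_ ?_ ?_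
    · rw [sub_nonneg, div_le_iff₀ (by linarith)]; linarith
    · exact mul_nonneg (div_nonneg hβ (by linarith)) hB0
    · exact mul_nonneg (div_nonneg hβ (by linarith)) hD0
    · have : (β / (-A)) • k = (β / (-A)) • (A • y + B • t₁ + D • t₂) := by rw [← hkdec]
      have h2 : β • y = -((β / (-A) * A) • y) := by
        have hA0 := hAneg.ne
        rw [← neg_smul]; congr 1; field_simp
      rw [hp, h2]
      have h3 : (β / (-A) * A) • y = (β / (-A)) • k - (β / (-A) * B) • t₁
          - (β / (-A) * D) • t₂ := by rw [this]; module
      rw [h3]; module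
  · push Not at hneg
    obtain ⟨A', hA'⟩ : ∃ A', A' = α * A + β := ⟨_, rfl⟩
    obtain ⟨B', hB'⟩ : ∃ B', B' = α * B := ⟨_, rfl⟩
    obtain ⟨D', hD'⟩ : ∃ D', D' = α * D := ⟨_, rfl⟩
    rw [← hA'] at hneg
    have hB'0 : 0 ≤ B' := by rw [hB']; positivity
    have hD'0 : 0 ≤ D' := by rw [hD']; positivity
    have hpd : p = A' • y + B' • t₁ + D' • t₂ := by
      rw [hp, hkdec, hA', hB', hD']; module
    have n1 : ‖t₁‖ = 1 := (us_iff _).1 (tmem τ hκτ).1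
    have n2 : ‖t₂‖ = 1 := (us_iff _).1 (tmem (-τ) (by linarith [neg_sq τ])).1
    have n3 : ‖y‖ = 1 := (us_iff _).1 hys
    have hsum : 1 ≤ A' + B' + D' := by
      rw [← (us_iff p).1 hps, hpd]
      refine (norm_add_le _ _).trans ?_
      have := norm_add_le (A' • y) (B' • t₁)
      rw [norm_smul, norm_smul, n1, n3, Real.norm_of_nonneg hneg, Real.norm_of_nonneg hB'0] at this
      rw [norm_smul, n2, Real.norm_of_nonneg hD'0]; linarith
    obtain ⟨px, hpx⟩ : ∃ px, px = A' * C + Q * (B' + D') := ⟨_, rfl⟩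
    obtain ⟨py, hpy⟩ : ∃ py, py = A' * S + P * κ * (B' + D') := ⟨_, rfl⟩
    obtain ⟨pz, hpz⟩ : ∃ pz, pz = P * τ * (B' - D') := ⟨_, rfl⟩
    have hpc : p = px • x + py • g + pz • f := by
      rw [hpd, hpx, hpy, hpz, hy, ht₁, ht₂]; module
    have hn : px ^ 2 + py ^ 2 + pz ^ 2 = 1 := by
      have := us_inner hps
      rw [hpc, F.inner] at this; linarith
    have hpx1 : C ≤ px := by
      have h1 := mul_le_mul_of_nonneg_left hsum hC.le
      have h2 := mul_le_mul_of_nonneg_right hCQ (add_nonneg hB'0 hD'0)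
      rw [hpx]; linarith
    have hpx2 : px ≤ Q := by
      by_contra hcon
      push Not at hcon
      apply hp0
      apply subset_sconv'
      apply hball
      refine ⟨hps, ?_⟩
      rw [gdist_le_iff hxs hps hρ.le (by linarith), hpc, hQ']
      simp only [inner_add_right, real_inner_smul_right, F.cc, F.ce, F.cf]
      linarith
    have hPκ : 0 < P * κ := mul_pos hP hκ
    have hpy0 : 0 < py := by
      rw [hpy]
      rcases hneg.eq_or_lt with h | h
      · have : 0 < B' + D' := by linarith
        rw [← h]; positivity
      · positivity
    have hpz1 : |pz| ≤ τ / κ * py := by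
      have h1 : τ / κ * py = τ / κ * (A' * S) + P * τ * (B' + D') := by
        rw [hpy]; field_simp
      have h2 : 0 ≤ τ / κ * (A' * S) := by positivity
      have h3 : 0 ≤ P * τ := by positivity
      rw [h1, hpz, abs_le]
      constructor
      · nlinarith [mul_nonneg h3 hB'0]
      · nlinarith [mul_nonneg h3 hD'0]
    obtain ⟨s, hs1, hs2, hs3⟩ := polar_coords hn hpy0 hpz1
    refine ⟨Real.arccos px, s, ?_, ?_, hs1, ?_⟩
    · rw [← acQ]; exact Real.arccos_le_arccos hpx2
    · rw [← acC]; exact Real.arccos_le_arccos hpx1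
    · rw [Real.cos_arccos (by linarith) (hpx2.trans (hQ' ▸ Real.cos_le_one ρ)), ← hs2, ← hs3]; exact hpc

theorem area_sub_le {A B P : Set (E 2)} {b : ℝ} (hb : 0 ≤ b) (hBA : B ⊆ A) (h : A \ B ⊆ P)
    (hP : μH[2] P ≤ ENNReal.ofReal b) : area A - area B ≤ b := by
  unfold area
  have h0 : μH[2] A ≤ μH[2] B + ENNReal.ofReal b := by
    refine (measure_mono (t := B ∪ P) ?_).trans ((measure_union_le _ _).trans ?_)
    · intro x hx
      by_cases hxB : x ∈ B
      · exact Or.inl hxB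
      · exact Or.inr (h ⟨hx, hxB⟩)
    · gcongr
  by_cases hT : μH[2] B = ⊤
  · have : μH[2] A = ⊤ := top_le_iff.1 (hT ▸ measure_mono hBA)
    rw [hT, this]; simpa using hb
  · have := ENNReal.toReal_mono (by finiteness) h0
    rw [ENNReal.toReal_add hT (by finiteness), ENNReal.toReal_ofReal hb] at this
    linarith

theorem kappa_exists {ρ ε δ D : ℝ} (hρ : 0 < ρ) (hε : 0 < ε) (hρε : ρ + ε < π / 2)
    (hD : D = Real.cos ρ * Real.sin ρ) (hδ0 : 0 < δ) (hδ1 : δ ≤ 1) (hεD : ε ≤ D * δ ^ 2 / 8) :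
    ∃ κ τ : ℝ, 0 < κ ∧ 0 < τ ∧ κ ^ 2 + τ ^ 2 = 1 ∧
      Real.cos ρ * Real.sin (ρ + ε) * κ = Real.sin ρ * Real.cos (ρ + ε) ∧
      1 - κ ≤ δ / 2 ∧ κ ≤ 1 ∧ τ ≤ δ / 2 ∧ τ / κ ≤ 2 * √(2 / D) * √ε := by
  have hpi := Real.pi_pos
  have hP : 0 < Real.sin ρ := Real.sin_pos_of_pos_of_lt_pi hρ (by linarith)
  have hQ : 0 < Real.cos ρ := Real.cos_pos_of_mem_Ioo ⟨by linarith, by linarith⟩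
  have hS : 0 < Real.sin (ρ + ε) := Real.sin_pos_of_pos_of_lt_pi (by linarith) (by linarith)
  have hC : 0 < Real.cos (ρ + ε) := Real.cos_pos_of_mem_Ioo ⟨by linarith, by linarith⟩
  have hPS : Real.sin ρ ≤ Real.sin (ρ + ε) :=
    Real.sin_le_sin_of_le_of_le_pi_div_two (by linarith) (by linarith) (by linarith)
  have hD0 : 0 < D := by rw [hD]; positivity
  have hQS : D ≤ Real.cos ρ * Real.sin (ρ + ε) := by rw [hD]; gcongr
  have hse0 : 0 < Real.sin ε := Real.sin_pos_of_pos_of_lt_pi hε (by linarith)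
  have hse : Real.sin ε ≤ ε := Real.sin_le hε.le
  have hsin : Real.sin ε = Real.cos ρ * Real.sin (ρ + ε) - Real.sin ρ * Real.cos (ρ + ε) := by
    have : Real.sin ε = Real.sin ((ρ + ε) - ρ) := by congr 1; ring
    rw [this, Real.sin_sub]; ring
  obtain ⟨κ, hκ⟩ : ∃ κ, κ = Real.sin ρ * Real.cos (ρ + ε) / (Real.cos ρ * Real.sin (ρ + ε)) :=
    ⟨_, rfl⟩
  have h1κ : 1 - κ = Real.sin ε / (Real.cos ρ * Real.sin (ρ + ε)) := by
    rw [hκ, hsin]; field_simp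
  have hκ1 : κ < 1 := by
    have : 0 < 1 - κ := by rw [h1κ]; positivity
    linarith
  have hκ0 : 0 < κ := by rw [hκ]; positivity
  have hb : 1 - κ ≤ ε / D := by
    rw [h1κ]; exact div_le_div₀ hε.le hse hD0 hQS
  have hεD2 : ε / D ≤ δ ^ 2 / 8 := by rw [div_le_iff₀ hD0]; linarith
  have hδ2 : δ ^ 2 ≤ δ := by nlinarith
  have hτ0 : 0 < 1 - κ ^ 2 := by nlinarith
  have hτ : √(1 - κ ^ 2) ^ 2 = 1 - κ ^ 2 := Real.sq_sqrt hτ0.le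
  have hτb : 1 - κ ^ 2 ≤ 2 / D * ε := by
    have : 2 / D * ε = 2 * (ε / D) := by ring
    rw [this]; nlinarith
  have hτ' : √(1 - κ ^ 2) ≤ √(2 / D) * √ε := by
    rw [← Real.sqrt_mul (by positivity)]; exact Real.sqrt_le_sqrt hτb
  refine ⟨κ, √(1 - κ ^ 2), hκ0, Real.sqrt_pos.2 hτ0, by linarith, ?_, by linarith, hκ1.le, ?_, ?_⟩
  · rw [hκ]; field_simp
  · apply Real.sqrt_le_iff.2
    refine ⟨by linarith, ?_⟩
    have : 2 / D * ε = 2 * (ε / D) := by ring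
    nlinarith
  · rw [div_le_iff₀ hκ0]
    have h12 : 1 / 2 ≤ κ := by linarith
    have : 0 ≤ √(2 / D) * √ε := by positivity
    nlinarith

theorem Cfg.u_cond (G : Cfg r R c e f x₁ x₂ x₃) {κ τ δ : ℝ} (hδ : δ = Real.sin (r - R))
    (hδ0 : 0 < δ) (hκ : 1 - κ ≤ δ / 2) (hκ1 : κ ≤ 1) (hκτ : κ ^ 2 + τ ^ 2 = 1) (hτ : |τ| ≤ δ / 2)
    {b : E 2} (hb : b ∈ balls r x₁ x₂ x₃) :
    ⟪b, (-Real.sin (π / 2 - r)) • x₁ + (Real.cos (π / 2 - r) * κ) •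
      ((-Real.sin R) • c + Real.cos R • e + (0 : ℝ) • f) +
      (Real.cos (π / 2 - r) * τ) • f⟫ ≤ 0 := by
  have F1 := G.frame1
  obtain ⟨i12, i23, i13⟩ := G.inners
  have hsR := G.sinR
  have hcR := G.cosR
  have hsr := G.sinr
  have hcr := G.cosr
  have hRR := Real.sin_sq_add_cos_sq R
  have hrr := Real.sin_sq_add_cos_sq r
  have hx2g : ⟪((-Real.sin R) • c + Real.cos R • e + (0 : ℝ) • f), x₂⟫ =
      -(3 / 2 * Real.sin R * Real.cos R) := by
    rw [G.e2, G.F.inner]; ring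
  have hx3g : ⟪((-Real.sin R) • c + Real.cos R • e + (0 : ℝ) • f), x₃⟫ =
      -(3 / 2 * Real.sin R * Real.cos R) := by
    rw [G.e3, G.F.inner]; ring
  have hx2f : ⟪f, x₂⟫ = Real.sin R * (√3 / 2) := by
    rw [G.e2]; simp only [inner_add_right, real_inner_smul_right, G.F.fc, G.F.fe, G.F.ff]; ring
  have hx3f : ⟪f, x₃⟫ = -(Real.sin R * (√3 / 2)) := by
    rw [G.e3]; simp only [inner_add_right, real_inner_smul_right, G.F.fc, G.F.fe, G.F.ff]; ring
  have hgx : ⟪((-Real.sin R) • c + Real.cos R • e + (0 : ℝ) • f), x₁⟫ = 0 := F1.ec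
  rw [Real.sin_sub] at hδ
  have ha : 1 - Real.cos r = 3 / 2 * Real.sin R ^ 2 := by rw [G.hcos]; linarith
  have h3 : √3 / 2 ≤ 1 := by
    have : √3 ≤ 2 := Real.sqrt_le_iff.2 ⟨by norm_num, by norm_num⟩
    linarith
  have h30 : 0 ≤ √3 / 2 := by positivity
  have key : ∀ τ' : ℝ, |τ'| ≤ δ / 2 → -Real.cos r * Real.cos r + Real.sin r * κ *
      (-(3 / 2 * Real.sin R * Real.cos R)) + Real.sin r * τ' * (Real.sin R * (√3 / 2)) ≤
      -Real.cos r := by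
    intro τ' hτ'
    have hs1 := Real.sin_le_one r
    have hc1 := Real.cos_le_one R
    have q1 : Real.sin r * Real.cos R * (1 - κ) ≤ δ / 2 := by
      have : Real.sin r * Real.cos R ≤ 1 := mul_le_one₀ hs1 hcR.le hc1
      have := mul_le_mul_of_nonneg_right this (sub_nonneg.2 hκ1)
      linarith
    have q2 : Real.sin r * τ' * (√3 / 2) ≤ δ / 2 := by
      have h1 : Real.sin r * (√3 / 2) ≤ 1 := mul_le_one₀ hs1 h30 h3
      have h2 := mul_le_mul_of_nonneg_left ((le_abs_self τ').trans hτ')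
        (mul_nonneg hsr.le h30)
      have h4 := mul_le_mul_of_nonneg_right h1 (show 0 ≤ δ / 2 by linarith)
      linarith
    have q3 : 0 ≤ 3 / 2 * δ - 3 / 2 * (Real.sin r * Real.cos R * (1 - κ)) -
      Real.sin r * τ' * (√3 / 2) := by linarith
    have q4 := mul_nonneg hsR.le q3
    have q5 : Real.sin R * (3 / 2 * δ - 3 / 2 * (Real.sin r * Real.cos R * (1 - κ)) -
      Real.sin r * τ' * (√3 / 2)) = -Real.cos r - (-Real.cos r * Real.cos r + Real.sin r * κ *
      (-(3 / 2 * Real.sin R * Real.cos R)) + Real.sin r * τ' * (Real.sin R * (√3 / 2))) := by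
      rw [hδ]; linear_combination Real.cos r * ha
    linarith
  rw [Real.sin_pi_div_two_sub, Real.cos_pi_div_two_sub]
  refine G.polar_balls ?_ ?_ ?_ ?_ hb
  · apply us_of_inner
    rw [F1.inner]; linear_combination hrr + Real.sin r ^ 2 * hκτ
  · rw [inner_add_left, inner_add_left, real_inner_smul_left, real_inner_smul_left,
      real_inner_smul_left, F1.cc, hgx, F1.fc]
    linarith
  · rw [inner_add_left, inner_add_left, real_inner_smul_left, real_inner_smul_left,
      real_inner_smul_left, i12, hx2g, hx2f]
    exact key τ hτ
  · rw [inner_add_left, inner_add_left, real_inner_smul_left, real_inner_smul_left,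
      real_inner_smul_left, i13, hx3g, hx3f]
    have := key (-τ) (by rwa [abs_neg])
    linarith

theorem sin_le_sin_add {x ε : ℝ} (hε : 0 ≤ ε) : Real.sin (x + ε) ≤ Real.sin x + ε := by
  have h1 := Real.abs_sin_sub_sin_le (x + ε) x
  rw [add_sub_cancel_left, abs_of_nonneg hε] at h1
  linarith [le_abs_self (Real.sin (x + ε) - Real.sin x)]

theorem cos_sub_le_cos {x ε : ℝ} (hε : 0 ≤ ε) : Real.cos x - ε ≤ Real.cos (x + ε) := by
  have h1 := Real.abs_cos_sub_cos_le (x + ε) x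
  rw [add_sub_cancel_left, abs_of_nonneg hε] at h1
  linarith [neg_abs_le (Real.cos (x + ε) - Real.cos x)]

theorem Cfg.g0_pos (G : Cfg r R c e f x₁ x₂ x₃) :
    0 < Real.cos r * (Real.sin r - 3 / 2 * Real.sin R * Real.cos R) := by
  have hsR := G.sinR
  have hcR := G.cosR
  have hsr := G.sinr
  have hcr := G.cosr
  have hRR := Real.sin_sq_add_cos_sq R
  have hrr := Real.sin_sq_add_cos_sq r
  have ha : 1 - Real.cos r = 3 / 2 * Real.sin R ^ 2 := by rw [G.hcos]; linarith
  apply mul_pos hcr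
  have h : 3 / 2 * Real.sin R * Real.cos R < Real.sin r := by
    refine lt_of_pow_lt_pow_left₀ 2 hsr.le ?_
    have e1 : Real.sin r ^ 2 = 3 * Real.sin R ^ 2 - 9 / 4 * Real.sin R ^ 4 := by
      have : Real.cos r = 1 - 3 / 2 * Real.sin R ^ 2 := by linarith
      rw [this] at hrr; linarith
    have e2 : (3 / 2 * Real.sin R * Real.cos R) ^ 2 =
        9 / 4 * Real.sin R ^ 2 - 9 / 4 * Real.sin R ^ 4 := by
      have : Real.cos R ^ 2 = 1 - Real.sin R ^ 2 := by linarith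
      rw [mul_pow, this]; ring
    rw [e1, e2]
    have : 0 < Real.sin R ^ 2 := by positivity
    linarith
  linarith

theorem Cfg.final (G : Cfg r R c e f x₁ x₂ x₃) :
    ∃ ε₀ > 0, ∃ k > 0, ∃ k' > 0, ∀ ε, 0 < ε → ε < ε₀ →
      ∀ y : E 2, y ∈ unitSphere 2 → y = Real.cos (π / 2 - r + ε) • x₁ +
        Real.sin (π / 2 - r + ε) • ((-Real.sin R) • c + Real.cos R • e + (0 : ℝ) • f) →
        width (sconv (sconv (balls r x₁ x₂ x₃) ∪ {y})) = π - r ∧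
        (∀ U : Set (E 2), IsReuleaux U r →
          k * ε ≤ hausdorffG (sconv (sconv (balls r x₁ x₂ x₃) ∪ {y})) (polar U)) ∧
        area (sconv (sconv (balls r x₁ x₂ x₃) ∪ {y})) - area (sconv (balls r x₁ x₂ x₃))
          ≤ k' * ε ^ ((3 : ℝ) / 2) := by
  have hpi := Real.pi_pos
  have hr0 := G.hr0
  have hr1 := G.hr1
  have hR0 := G.hR0
  have hRr := G.hRr
  have hsR := G.sinR
  have hcR := G.cosR
  have hsr := G.sinr
  have hcr := G.cosr
  have hg0 := G.g0_pos
  obtain ⟨i12, i23, i13⟩ := G.inners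
  obtain ⟨δ, hδ⟩ : ∃ δ, δ = Real.sin (r - R) := ⟨_, rfl⟩
  have hδ0 : 0 < δ := by rw [hδ]; exact Real.sin_pos_of_pos_of_lt_pi (by linarith) (by linarith)
  have hδ1 : δ ≤ 1 := by rw [hδ]; exact Real.sin_le_one _
  obtain ⟨D, hD⟩ : ∃ D, D = Real.cos (π / 2 - r) * Real.sin (π / 2 - r) := ⟨_, rfl⟩
  have hD0 : 0 < D := by
    rw [hD, Real.cos_pi_div_two_sub, Real.sin_pi_div_two_sub]; positivity
  obtain ⟨g0, hg⟩ : ∃ g0, g0 = Real.cos r * (Real.sin r - 3 / 2 * Real.sin R * Real.cos R) :=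
    ⟨_, rfl⟩
  rw [← hg] at hg0
  obtain ⟨σ, hσ⟩ : ∃ σ, σ = R + π / 2 - r := ⟨_, rfl⟩
  have hsσ : 0 < Real.sin σ := Real.sin_pos_of_pos_of_lt_pi (by linarith) (by linarith)
  refine ⟨min (r - R) (min (D * δ ^ 2 / 8) (g0 / 3)), ?_, Real.sin σ ^ 2 / 3, by positivity,
    16 * √(2 / D), by positivity, ?_⟩
  · exact lt_min (by linarith) (lt_min (by positivity) (by positivity))
  intro ε hε hεlt y hys hy
  rw [lt_min_iff, lt_min_iff] at hεlt
  obtain ⟨ε1, ε2, ε3⟩ := hεlt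
  have F1 := G.frame1
  have hx2g : ⟪((-Real.sin R) • c + Real.cos R • e + (0 : ℝ) • f), x₂⟫ =
      -(3 / 2 * Real.sin R * Real.cos R) := by
    rw [G.e2, G.F.inner]; ring
  have hx3g : ⟪((-Real.sin R) • c + Real.cos R • e + (0 : ℝ) • f), x₃⟫ =
      -(3 / 2 * Real.sin R * Real.cos R) := by
    rw [G.e3, G.F.inner]; ring
  have hyσ : y = Real.cos (σ + ε) • c + Real.sin (σ + ε) • e + (0 : ℝ) • f := by
    have e1 : σ + ε = (π / 2 - r + ε) + R := by rw [hσ]; ring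
    rw [hy, e1, Real.cos_add (π / 2 - r + ε) R, Real.sin_add (π / 2 - r + ε) R]
    conv_lhs => rw [G.e1]
    module
  have hcy : 0 < ⟪c, y⟫ := by
    rw [hyσ]
    simp only [inner_add_right, real_inner_smul_right, G.F.cc, G.F.ce, G.F.cf]
    have : 0 < Real.cos (σ + ε) := Real.cos_pos_of_mem_Ioo ⟨by linarith, by linarith⟩
    linarith
  have hyx : 0 ≤ Real.cos (π / 2 - r + ε) * Real.cos r +
      Real.sin (π / 2 - r + ε) * (-(3 / 2 * Real.sin R * Real.cos R)) := by
    have h1 := sin_le_sin_add (x := π / 2 - r) hε.le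
    have h2 := cos_sub_le_cos (x := π / 2 - r) hε.le
    rw [Real.sin_pi_div_two_sub] at h1
    rw [Real.cos_pi_div_two_sub] at h2
    have h3 := mul_le_mul_of_nonneg_right h2 hcr.le
    have hsc : 0 ≤ 3 / 2 * Real.sin R * Real.cos R := by positivity
    have h4 := mul_le_mul_of_nonneg_right h1 hsc
    have h5 : ε * Real.cos r ≤ ε := mul_le_of_le_one_right hε.le (Real.cos_le_one _)
    have h6 : Real.sin R * Real.cos R ≤ 1 :=
      mul_le_one₀ (Real.sin_le_one _) hcR.le (Real.cos_le_one _)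
    have h7 := mul_le_mul_of_nonneg_left h6 hε.le
    nlinarith
  refine ⟨G.width_part hys hcy ?_ ?_, fun U hU => G.haus_part hε hσ (by linarith) hyσ hU, ?_⟩
  · rw [hy, inner_add_left, real_inner_smul_left, real_inner_smul_left, i12, hx2g]; exact hyx
  · rw [hy, inner_add_left, real_inner_smul_left, real_inner_smul_left, i13, hx3g]; exact hyx
  obtain ⟨κ, τ, hκ, hτ, hκτ, hk, hκδ, hκ1, hτδ, hq⟩ := kappa_exists (ρ := π / 2 - r)
    (by linarith) hε (by linarith) hD hδ0 hδ1 ε2.le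
  have hreg := region (ρ := π / 2 - r) (y := y) F1 G.cs (fun b hb => G.ball_c hb) (by linarith)
    hε (by linarith) hκ hτ hκτ hk (hy.trans (by module)) hcy
    (fun b hb => Or.inl (Or.inl hb))
    (fun b hb => G.u_cond hδ hδ0 hκδ hκ1 hκτ (by rwa [abs_of_pos hτ]) hb)
    (fun b hb => by
      have := G.u_cond hδ hδ0 hκδ hκ1 (τ := -τ) (by rw [neg_sq]; exact hκτ)
        (by rwa [abs_neg, abs_of_pos hτ]) hb
      rwa [mul_neg] at this)
  have harea := area_sub_le (b := 8 * (τ / κ) * ε) (by positivity)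
    (fun b hb => subset_sconv' _ (Or.inl hb)) hreg (prect_area F1 hε.le (by positivity))
  refine harea.trans ?_
  have he : ε ^ ((3 : ℝ) / 2) = ε * √ε := by
    rw [show (3 : ℝ) / 2 = 1 + 1 / 2 by norm_num, Real.rpow_add hε, Real.rpow_one,
      Real.sqrt_eq_rpow]
  rw [he]
  have := mul_le_mul_of_nonneg_right hq hε.le
  linarith

end SphericalPal

open SphericalPal

/-- optimality of the stability order for `w > π/2`: the bodies
`K_ε = conv(U°_{π-w} ∪ {y})`, where `y` sticks out by `ε` beyond the midpoint `m₁` of the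
circular arc of `∂U°_{π-w}` in `∂B₁`, have width `w`, lie at Hausdorff distance `≥ c_w·ε`
from every polar Reuleaux triangle, and exceed the minimal area by at most `c_w'·ε^{3/2}`. -/
theorem optimality_large_width (w : ℝ) (hw1 : π / 2 < w) (hw2 : w < π)
    (x₁ x₂ x₃ : E 2) (hx : IsRegularCenters x₁ x₂ x₃ (π - w))
    (z : E 2) (hz : z ∈ seg x₂ x₃ ∧ gdist x₂ z = gdist x₃ z)
    (m₁ : E 2) (hm : m₁ ∈ unitSphere 2 ∧ gdist x₁ m₁ = w - π / 2 ∧ x₁ ∈ seg z m₁) :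
    ∃ ε₀ > 0, ∃ c > 0, ∃ c' > 0, ∀ ε, 0 < ε → ε < ε₀ →
      ∀ y : E 2, y ∈ unitSphere 2 → gdist m₁ y = ε → m₁ ∈ seg x₁ y →
        width (sconv (polarReuleaux x₁ x₂ x₃ w ∪ {y})) = w ∧
        (∀ U : Set (E 2), IsReuleaux U (π - w) →
          c * ε ≤ hausdorffG (sconv (polarReuleaux x₁ x₂ x₃ w ∪ {y})) (polar U)) ∧
        area (sconv (polarReuleaux x₁ x₂ x₃ w ∪ {y})) - area (polarReuleaux x₁ x₂ x₃ w)
          ≤ c' * ε ^ ((3 : ℝ) / 2) := by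
  have hρ : w - π / 2 = π / 2 - (π - w) := by ring
  obtain ⟨R, c, e, f, G⟩ := cfg_exists (r := π - w) (by linarith) (by linarith) hx
  obtain ⟨ε₀, h0, k, hk, k', hk', H⟩ := G.final
  refine ⟨ε₀, h0, k, hk, k', hk', fun ε hε hεlt y hy hmy hmseg => ?_⟩
  rw [hρ] at hm
  have hyp := G.y_pos hz hm hy hmy hmseg
  obtain ⟨H1, H2, H3⟩ := H ε hε hεlt y hy hyp
  have hK : polarReuleaux x₁ x₂ x₃ w = sconv (balls (π - w) x₁ x₂ x₃) := by
    unfold polarReuleaux balls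
    rw [hρ]
  rw [hK]
  exact ⟨by rw [H1]; ring, H2, H3⟩
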